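/- arXiv:1211.2184 — 2 statements merged into one kernel-verified Lean document; each statement's English description precedes it below -/
import Mathlib

section
/- There exists a constant ε > 0 with the following property. Let H^−, H^+ ∈ C^∞(S^1 × T*ℝ^n) be admissible, let H ∈ C^∞(ℝ × S^1 × T*ℝ^n) be a homotopy from H^− to H^+ (i.e. H satisfies (HH1), (HH2), (HH3) and H(±s_0, t, ·) = H^±_t), and let J = (J_{s,t})_{(s,t)∈ℝ×S^1} be a smooth family of almost complex structures on T*ℝ^n satisfying (JJ1), each J_{s,t} compatible with ω_n, and sup_{s,t} ‖J_{s,t} − J_std‖_{C^0} < ε. Then for any x_− ∈ 𝒫(H^−) and x_+ ∈ 𝒫(H^+), the set ℳ_{H,J}(x_−, x_+) of smooth solutions u : ℝ × S^1 → T*ℝ^n of ∂_s u − J_{s,t}(u)(∂_t u − X_{H_{s,t}}(u)) = 0 with lim_{s→±∞} u(s,·) = x_± uniformly is C^0-bounded. -/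
/-!
Statement 1: C⁰-bound for continuation Floer trajectories of a monotone homotopy
of admissible Hamiltonians on `T*ℝⁿ` (Lemma 2.5 of the paper).
-/

open scoped RealInnerProductSpace
open Filter

noncomputable section

abbrev E (n : ℕ) : Type := EuclideanSpace ℝ (Fin n)

abbrev P (n : ℕ) : Type := E n × E n

/-- The standard symplectic form `ω_n = Σ dp_i ∧ dq_i` on `T*ℝⁿ`. -/
def omegaN {n : ℕ} (ξ η : P n) : ℝ := ⟪ξ.2, η.1⟫ - ⟪ξ.1, η.2⟫

/-- The Hamiltonian vector field `X_K(q,p) = (∂_p K(q,p), −∂_q K(q,p))`. -/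
def XH {n : ℕ} (K : P n → ℝ) (z : P n) : P n :=
  (gradient (fun p => K (z.1, p)) z.2, -gradient (fun q => K (q, z.2)) z.1)

/-- `Q^a(q,p) = a(|q|² + |p|²)`. -/
def Qa {n : ℕ} (a : ℝ) (z : P n) : ℝ := a * (‖z.1‖ ^ 2 + ‖z.2‖ ^ 2)

/-- The standard complex structure `J_std(ξ_q, ξ_p) = (ξ_p, −ξ_q)`. -/
def Jstd (n : ℕ) : P n →L[ℝ] P n :=
  (ContinuousLinearMap.snd ℝ (E n) (E n)).prod (-(ContinuousLinearMap.fst ℝ (E n) (E n)))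

/-- Compatibility with `ω_n`. -/
def Compatible {n : ℕ} (Jz : P n →L[ℝ] P n) : Prop :=
  (∀ ξ η : P n, omegaN ξ (Jz η) = omegaN η (Jz ξ)) ∧
  (∀ ξ : P n, ξ ≠ 0 → 0 < omegaN ξ (Jz ξ))

/-- `x ∈ 𝒫(H)`. -/
structure IsPeriodicOrbit {n : ℕ} (H : ℝ → P n → ℝ) (x : ℝ → P n) : Prop where
  smooth : ContDiff ℝ (⊤ : ℕ∞) x
  periodic : ∀ t, x (t + 1) = x t
  eqn : ∀ t, deriv x t = XH (H t) (x t)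

/-- Nondegeneracy of a periodic orbit. -/
def Nondeg {n : ℕ} (H : ℝ → P n → ℝ) (x : ℝ → P n) : Prop :=
  ∀ ξ : ℝ → P n, ContDiff ℝ (⊤ : ℕ∞) ξ → (∀ t, ξ (t + 1) = ξ t) →
    (∀ t, deriv ξ t = fderiv ℝ (XH (H t)) (x t) (ξ t)) → ξ = 0

/-- Admissibility: (H0) and (H1). -/
structure Admissible {n : ℕ} (H : ℝ → P n → ℝ) : Prop where
  smooth : ContDiff ℝ (⊤ : ℕ∞) (fun z : ℝ × P n => H z.1 z.2)
  periodic : ∀ t z, H (t + 1) z = H t z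
  h0 : ∀ x : ℝ → P n, IsPeriodicOrbit H x → Nondeg H x
  h1 : ∃ a : ℝ, 0 < a ∧ (∀ k : ℤ, a ≠ (k : ℝ) * Real.pi) ∧
      ∃ C : ℝ, ∀ t z, |H t z - Qa a z| ≤ C ∧
        ‖fderiv ℝ (fun w => H t w - Qa a w) z‖ ≤ C

/-- A homotopy of Hamiltonians from `Hm` to `Hp`: a smooth family
`H : ℝ × S¹ × T*ℝⁿ → ℝ` satisfying (HH1), (HH2), (HH3),
with `H(s,·) = Hp` for `s ≥ s₀` and `H(s,·) = Hm` for `s ≤ −s₀`. -/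
structure IsHomotopy {n : ℕ} (Hm Hp : ℝ → P n → ℝ) (H : ℝ → ℝ → P n → ℝ) : Prop where
  smooth : ContDiff ℝ (⊤ : ℕ∞) (fun z : ℝ × ℝ × P n => H z.1 z.2.1 z.2.2)
  periodic : ∀ s t z, H s (t + 1) z = H s t z
  /-- (HH1), together with the matching conditions `H(±s₀,t,·) = H^±_t`. -/
  hh1 : ∃ s₀ > (0 : ℝ), (∀ s t z, s₀ ≤ s → H s t z = Hp t z) ∧
      (∀ s t z, s ≤ -s₀ → H s t z = Hm t z)
  /-- (HH2): `∂_s H ≥ 0`. -/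
  hh2 : ∀ s t z, 0 ≤ deriv (fun s' => H s' t z) s
  /-- (HH3). -/
  hh3 : ∃ a : ℝ → ℝ, ContDiff ℝ (⊤ : ℕ∞) a ∧ (∀ s, 0 ≤ deriv a s) ∧
      (∀ s, (∃ k : ℤ, a s = (k : ℝ) * Real.pi) → 0 < deriv a s) ∧
      ∃ C : ℝ, ∀ s t z,
        |H s t z - Qa (a s) z| ≤ C ∧
        ‖fderiv ℝ (fun w => H s t w - Qa (a s) w) z‖ ≤ C ∧
        |deriv (fun s' => H s' t z - Qa (a s') z) s| ≤ C

/-- A continuation Floer trajectory for the homotopies `(H_{s,t})`, `(J_{s,t})`. -/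
structure ContinuationSol {n : ℕ} (H : ℝ → ℝ → P n → ℝ)
    (J : ℝ → ℝ → P n → P n →L[ℝ] P n)
    (xm xp : ℝ → P n) (u : ℝ → ℝ → P n) : Prop where
  smooth : ContDiff ℝ (⊤ : ℕ∞) (fun z : ℝ × ℝ => u z.1 z.2)
  periodic : ∀ s t, u s (t + 1) = u s t
  eqn : ∀ s t, deriv (fun s' => u s' t) s =
      J s t (u s t) (deriv (fun t' => u s t') t - XH (H s t) (u s t))
  tendsto_bot : TendstoUniformly (fun s t => u s t) xm atBot
  tendsto_top : TendstoUniformly (fun s t => u s t) xp atTop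

theorem hasDerivAt_integral_param {V : Type*} [NormedAddCommGroup V] [NormedSpace ℝ V]
    {F F' : ℝ → ℝ → V} (a b : ℝ)
    (hF : Continuous (Function.uncurry F)) (hF' : Continuous (Function.uncurry F'))
    (h : ∀ s t, HasDerivAt (fun s' => F s' t) (F' s t) s) (s : ℝ) :
    HasDerivAt (fun s' => ∫ t in a..b, F s' t) (∫ t in a..b, F' s t) s := by
  obtain ⟨M, hM⟩ := ((isCompact_Icc (a := s - 1) (b := s + 1)).prod
    (isCompact_uIcc (a := a) (b := b))).exists_bound_of_continuousOn hF'.continuousOn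
  refine (intervalIntegral.hasDerivAt_integral_of_dominated_loc_of_deriv_le
    (F := F) (F' := F') (bound := fun _ => M) (s := Set.Icc (s - 1) (s + 1))
    (Icc_mem_nhds (by linarith) (by linarith)) ?_ ?_ ?_ ?_ ?_ ?_).2
  · exact Eventually.of_forall fun x =>
      (show Continuous (F x) by fun_prop).aestronglyMeasurable
  · exact (show Continuous (F s) by fun_prop).intervalIntegrable _ _
  · exact (show Continuous (F' s) by fun_prop).aestronglyMeasurable
  · exact Eventually.of_forall fun t ht x hx => hM (x, t) ⟨hx, Set.uIoc_subset_uIcc ht⟩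
  · exact intervalIntegrable_const
  · exact Eventually.of_forall fun t _ x _ => h x t

theorem continuous_integral_param {V : Type*} [NormedAddCommGroup V] [NormedSpace ℝ V]
    {F : ℝ → ℝ → V} (a b : ℝ) (hF : Continuous (Function.uncurry F)) :
    Continuous fun s => ∫ t in a..b, F s t :=
  intervalIntegral.continuous_parametric_intervalIntegral_of_continuous' hF a b

theorem sq_intervalIntegral_le {f : ℝ → ℝ} (hf : Continuous f) {a b : ℝ} (hab : a < b) :
    (∫ t in a..b, f t) ^ 2 ≤ (b - a) * ∫ t in a..b, f t ^ 2 := by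
  set I := ∫ t in a..b, f t with hI
  have hpos : 0 < b - a := sub_pos.2 hab
  set c := I / (b - a) with hc
  have hi : ∀ g : ℝ → ℝ, Continuous g → IntervalIntegrable g MeasureTheory.volume a b :=
    fun g hg => hg.intervalIntegrable _ _
  have h0 : 0 ≤ ∫ t in a..b, (f t - c) ^ 2 :=
    intervalIntegral.integral_nonneg hab.le fun t _ => sq_nonneg _
  have h1 : ∫ t in a..b, (f t - c) ^ 2 =
      (∫ t in a..b, f t ^ 2) - 2 * c * I + c ^ 2 * (b - a) := by
    have : ∀ t, (f t - c) ^ 2 = f t ^ 2 - 2 * c * f t + c ^ 2 := fun t => by ring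
    simp_rw [this]
    rw [intervalIntegral.integral_add (hi _ (by fun_prop)) (hi _ (by fun_prop)),
      intervalIntegral.integral_sub (hi _ (by fun_prop)) (hi _ (by fun_prop)),
      intervalIntegral.integral_const_mul, intervalIntegral.integral_const, smul_eq_mul]
    ring
  have h2 : c * (b - a) = I := div_mul_cancel₀ _ hpos.ne'
  rw [h1] at h0
  have h3 : 0 ≤ (b - a) * ((∫ t in a..b, f t ^ 2) - 2 * c * I + c ^ 2 * (b - a)) :=
    mul_nonneg hpos.le h0
  have h4 : (b - a) * ((∫ t in a..b, f t ^ 2) - 2 * c * I + c ^ 2 * (b - a)) =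
      (b - a) * (∫ t in a..b, f t ^ 2) - 2 * (c * (b - a)) * I + (c * (b - a)) ^ 2 := by ring
  rw [h4, h2] at h3
  nlinarith

/-- A nonincreasing function satisfying `y² ≤ -C y'` near `-∞` wherever it is positive cannot be
positive: otherwise it would blow up in finite backward time. -/
theorem nonpos_of_sq_le_neg_deriv {y y' : ℝ → ℝ} {C s₁ : ℝ} (hC : 0 < C)
    (hy : ∀ s, HasDerivAt y (y' s) s) (hy' : ∀ s, y' s ≤ 0)
    (h : ∀ s ≤ s₁, 0 < y s → y s ^ 2 ≤ C * (-y' s)) (s : ℝ) : y s ≤ 0 := by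
  have hanti : Antitone y := antitone_of_deriv_nonpos (fun s => (hy s).differentiableAt)
    fun s => (hy s).deriv ▸ hy' s
  by_contra! hpos
  set s₂ := min s s₁
  have hp : ∀ r ≤ s₂, 0 < y r := fun r hr =>
    hpos.trans_le (hanti (hr.trans (min_le_left _ _)))
  have hd : ∀ r ≤ s₂, HasDerivAt (fun r => (y r)⁻¹ - r / C) (-y' r / y r ^ 2 - 1 / C) r :=
    fun r hr => ((hy r).inv (hp r hr).ne').sub ((hasDerivAt_id r).div_const C)
  have hmono : MonotoneOn (fun r => (y r)⁻¹ - r / C) (Set.Iic s₂) := by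
    apply monotoneOn_of_deriv_nonneg (convex_Iic _)
    · exact fun r hr => (hd r hr).continuousAt.continuousWithinAt
    · exact fun r hr =>
        (hd r (Set.mem_Iic.1 (interior_subset hr))).differentiableAt.differentiableWithinAt
    · intro r hr
      have hr' : r ≤ s₂ := Set.mem_Iic.1 (interior_subset hr)
      rw [(hd r hr').deriv, sub_nonneg, div_le_div_iff₀ hC (pow_pos (hp r hr') 2)]
      linarith [h r (hr'.trans (min_le_right _ _)) (hp r hr')]
  have hr : s₂ - C * (y s₂)⁻¹ - C ≤ s₂ := by
    have := mul_pos hC (inv_pos.2 (hp s₂ le_rfl)); linarith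
  have := hmono (Set.mem_Iic.2 hr) (Set.mem_Iic.2 le_rfl) hr
  simp only at this
  have hi := inv_pos.2 (hp _ hr)
  have he : (s₂ - C * (y s₂)⁻¹ - C) / C = s₂ / C - (y s₂)⁻¹ - 1 := by field_simp
  rw [he] at this
  linarith

section Symplectic

variable {n : ℕ}

theorem omegaN_add_left (ξ ξ' η : P n) : omegaN (ξ + ξ') η = omegaN ξ η + omegaN ξ' η := by
  simp [omegaN, inner_add_left]; ring

theorem omegaN_sub_left (ξ ξ' η : P n) : omegaN (ξ - ξ') η = omegaN ξ η - omegaN ξ' η := by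
  simp [omegaN, inner_sub_left]; ring

theorem omegaN_add_right (ξ η η' : P n) : omegaN ξ (η + η') = omegaN ξ η + omegaN ξ η' := by
  simp [omegaN, inner_add_right]; ring

theorem omegaN_sub_right (ξ η η' : P n) : omegaN ξ (η - η') = omegaN ξ η - omegaN ξ η' := by
  simp [omegaN, inner_sub_right]; ring

theorem omegaN_smul_left (c : ℝ) (ξ η : P n) : omegaN (c • ξ) η = c * omegaN ξ η := by
  simp [omegaN, inner_smul_left]; ring

theorem omegaN_smul_right (c : ℝ) (ξ η : P n) : omegaN ξ (c • η) = c * omegaN ξ η := by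
  simp [omegaN, inner_smul_right]; ring

theorem omegaN_swap (ξ η : P n) : omegaN η ξ = -omegaN ξ η := by
  simp only [omegaN, real_inner_comm]; ring

theorem omegaN_self (ξ : P n) : omegaN ξ ξ = 0 := by
  linarith [omegaN_swap ξ ξ]

theorem abs_omegaN_le (ξ η : P n) : |omegaN ξ η| ≤ 2 * ‖ξ‖ * ‖η‖ := by
  have h1 : |⟪ξ.2, η.1⟫| ≤ ‖ξ‖ * ‖η‖ := (abs_real_inner_le_norm _ _).trans
    (mul_le_mul (norm_snd_le ξ) (norm_fst_le η) (norm_nonneg _) (norm_nonneg _))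
  have h2 : |⟪ξ.1, η.2⟫| ≤ ‖ξ‖ * ‖η‖ := (abs_real_inner_le_norm _ _).trans
    (mul_le_mul (norm_fst_le ξ) (norm_snd_le η) (norm_nonneg _) (norm_nonneg _))
  have := abs_sub ⟪ξ.2, η.1⟫ ⟪ξ.1, η.2⟫
  unfold omegaN
  linarith

@[fun_prop]
theorem Continuous.omegaN {X : Type*} [TopologicalSpace X] {f g : X → P n}
    (hf : Continuous f) (hg : Continuous g) : Continuous fun x => omegaN (f x) (g x) := by
  unfold _root_.omegaN; fun_prop

theorem HasDerivAt.omegaN {f g : ℝ → P n} {f' g' : P n} {t : ℝ}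
    (hf : HasDerivAt f f' t) (hg : HasDerivAt g g' t) :
    HasDerivAt (fun t => omegaN (f t) (g t)) (omegaN f' (g t) + omegaN (f t) g') t := by
  have fst' : ∀ {k : ℝ → P n} {k' : P n}, HasDerivAt k k' t →
      HasDerivAt (fun t => (k t).1) k'.1 t := fun hk =>
    (ContinuousLinearMap.fst ℝ (E n) (E n)).hasFDerivAt.comp_hasDerivAt t hk
  have snd' : ∀ {k : ℝ → P n} {k' : P n}, HasDerivAt k k' t →
      HasDerivAt (fun t => (k t).2) k'.2 t := fun hk =>
    (ContinuousLinearMap.snd ℝ (E n) (E n)).hasFDerivAt.comp_hasDerivAt t hk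
  have := ((snd' hf).inner ℝ (fst' hg)).sub ((fst' hf).inner ℝ (snd' hg))
  refine this.congr_deriv ?_
  simp only [_root_.omegaN]; ring

theorem sq_norm_le_add_sq (z : P n) : ‖z‖ ^ 2 ≤ ‖z.1‖ ^ 2 + ‖z.2‖ ^ 2 := by
  rw [Prod.norm_def]
  rcases max_cases ‖z.1‖ ‖z.2‖ with ⟨h, _⟩ | ⟨h, _⟩ <;> rw [h] <;>
    nlinarith [sq_nonneg ‖z.1‖, sq_nonneg ‖z.2‖]

theorem add_sq_le_two_mul_sq_norm (z : P n) : ‖z.1‖ ^ 2 + ‖z.2‖ ^ 2 ≤ 2 * ‖z‖ ^ 2 := by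
  have h1 := pow_le_pow_left₀ (norm_nonneg _) (norm_fst_le z) 2
  have h2 := pow_le_pow_left₀ (norm_nonneg _) (norm_snd_le z) 2
  linarith

theorem norm_Jstd_apply (z : P n) : ‖Jstd n z‖ = ‖z‖ := by
  simp [Jstd, Prod.norm_def, max_comm]

theorem Jstd_Jstd (z : P n) : Jstd n (Jstd n z) = -z := by
  simp [Jstd, Prod.ext_iff]

theorem omegaN_Jstd (z : P n) : omegaN z (Jstd n z) = ‖z.1‖ ^ 2 + ‖z.2‖ ^ 2 := by
  simp [omegaN, Jstd]; ring

/-- Almost complex structures near `Jstd` are uniformly bounded. -/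
theorem norm_apply_le_of_near_Jstd {J : P n →L[ℝ] P n} (hJ : ‖J - Jstd n‖ ≤ 1 / 4) (ξ : P n) :
    ‖J ξ‖ ≤ 2 * ‖ξ‖ := by
  have h1 : ‖(J - Jstd n) ξ‖ ≤ 1 / 4 * ‖ξ‖ := (J - Jstd n).le_of_opNorm_le hJ ξ
  have h2 : J ξ = (J - Jstd n) ξ + Jstd n ξ := by simp
  rw [h2]
  refine (norm_add_le _ _).trans ?_
  rw [norm_Jstd_apply]
  linarith [norm_nonneg ξ]

/-- Almost complex structures near `Jstd` are uniformly tame. -/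
theorem half_sq_norm_le_omegaN {J : P n →L[ℝ] P n} (hJ : ‖J - Jstd n‖ ≤ 1 / 4) (ξ : P n) :
    ‖ξ‖ ^ 2 / 2 ≤ omegaN ξ (J ξ) := by
  have h1 : ‖(J - Jstd n) ξ‖ ≤ 1 / 4 * ‖ξ‖ := (J - Jstd n).le_of_opNorm_le hJ ξ
  have h2 : J ξ = (J - Jstd n) ξ + Jstd n ξ := by simp
  have h3 := abs_omegaN_le ξ ((J - Jstd n) ξ)
  have h4 : 2 * ‖ξ‖ * ‖(J - Jstd n) ξ‖ ≤ 2 * ‖ξ‖ * (1 / 4 * ‖ξ‖) :=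
    mul_le_mul_of_nonneg_left h1 (by positivity)
  rw [h2, omegaN_add_right, omegaN_Jstd]
  have h5 := sq_norm_le_add_sq ξ
  have := (abs_le.1 h3).1
  nlinarith

theorem omegaN_XH {K : P n → ℝ} {z : P n} (hK : DifferentiableAt ℝ K z) (ξ : P n) :
    omegaN ξ (XH K z) = fderiv ℝ K z ξ := by
  have h1 : HasFDerivAt (fun p => K (z.1, p))
      ((fderiv ℝ K z).comp (ContinuousLinearMap.inr ℝ (E n) (E n))) z.2 :=
    HasFDerivAt.comp (g := K) z.2 hK.hasFDerivAt (hasFDerivAt_prodMk_right z.1 z.2)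
  have h2 : HasFDerivAt (fun q => K (q, z.2))
      ((fderiv ℝ K z).comp (ContinuousLinearMap.inl ℝ (E n) (E n))) z.1 :=
    HasFDerivAt.comp (g := K) z.1 hK.hasFDerivAt (hasFDerivAt_prodMk_left z.1 z.2)
  have e1 : ⟪ξ.2, gradient (fun p => K (z.1, p)) z.2⟫ = fderiv ℝ K z (0, ξ.2) := by
    rw [real_inner_comm, gradient, InnerProductSpace.toDual_symm_apply, h1.fderiv]; simp
  have e2 : ⟪ξ.1, gradient (fun q => K (q, z.2)) z.1⟫ = fderiv ℝ K z (ξ.1, 0) := by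
    rw [real_inner_comm, gradient, InnerProductSpace.toDual_symm_apply, h2.fderiv]; simp
  simp only [omegaN, XH, inner_neg_right]
  rw [e1, e2, sub_neg_eq_add, ← map_add]
  simp

theorem norm_le_of_forall_omegaN_le {Y : P n} {C : ℝ}
    (h : ∀ ξ, |omegaN ξ Y| ≤ C * ‖ξ‖) (hC : 0 ≤ C) : ‖Y‖ ≤ C := by
  have aux : ∀ x : ℝ, 0 ≤ x → x ^ 2 ≤ C * x → x ≤ C := fun x hx hxC => by
    by_contra! hlt
    nlinarith
  refine norm_prod_le_iff.2 ⟨aux _ (norm_nonneg _) ?_, aux _ (norm_nonneg _) ?_⟩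
  · have := h (0, Y.1)
    simpa [omegaN, Prod.norm_def] using this
  · have := h (Y.2, 0)
    simpa [omegaN, Prod.norm_def] using this

theorem hasFDerivAt_Qa (a : ℝ) (z : P n) :
    ∃ L : P n →L[ℝ] ℝ, HasFDerivAt (Qa a) L z ∧
      ∀ ξ, L ξ = omegaN ξ ((2 * a) • Jstd n z) := by
  have h1 := (hasFDerivAt_fst (𝕜 := ℝ) (p := z)).norm_sq
  have h2 := (hasFDerivAt_snd (𝕜 := ℝ) (p := z)).norm_sq
  refine ⟨_, (h1.add h2).const_mul a, fun ξ => ?_⟩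
  simp [omegaN, Jstd, inner_smul_right, real_inner_comm]
  ring

/-- The Hamiltonian vector field of a `C¹`-bounded perturbation of `Qa a` is a bounded
perturbation of the linear field `2 a Jstd`. -/
theorem norm_XH_sub_le {K : P n → ℝ} {z : P n} {a C : ℝ} (hK : DifferentiableAt ℝ K z)
    (hC : ‖fderiv ℝ (fun w => K w - Qa a w) z‖ ≤ C) :
    ‖XH K z - (2 * a) • Jstd n z‖ ≤ C := by
  obtain ⟨L, hL, hL'⟩ := hasFDerivAt_Qa a z
  refine norm_le_of_forall_omegaN_le (fun ξ => ?_) ((norm_nonneg _).trans hC)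
  rw [omegaN_sub_right, omegaN_XH hK, ← hL']
  have : fderiv ℝ (fun w => K w - Qa a w) z = fderiv ℝ K z - L :=
    (hK.hasFDerivAt.sub hL).fderiv
  rw [this] at hC
  simpa using (fderiv ℝ K z - L).le_of_opNorm_le hC ξ

end Symplectic

section Action

variable {n : ℕ}

/-- Partial derivative in the first variable. -/
def pd₁ {V : Type*} [NormedAddCommGroup V] [NormedSpace ℝ V] (f : ℝ × ℝ → V) (z : ℝ × ℝ) : V :=
  fderiv ℝ f z (1, 0)

/-- Partial derivative in the second variable. -/
def pd₂ {V : Type*} [NormedAddCommGroup V] [NormedSpace ℝ V] (f : ℝ × ℝ → V) (z : ℝ × ℝ) : V :=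
  fderiv ℝ f z (0, 1)

section Partial

variable {V : Type*} [NormedAddCommGroup V] [NormedSpace ℝ V] {f : ℝ × ℝ → V}

theorem hasDerivAt_pd₁ {s t : ℝ} (hf : DifferentiableAt ℝ f (s, t)) :
    HasDerivAt (fun s => f (s, t)) (pd₁ f (s, t)) s :=
  HasFDerivAt.comp_hasDerivAt (f := fun s => (s, t)) s hf.hasFDerivAt
    ((hasDerivAt_id s).prodMk (hasDerivAt_const s t))

theorem hasDerivAt_pd₂ {s t : ℝ} (hf : DifferentiableAt ℝ f (s, t)) :
    HasDerivAt (fun t => f (s, t)) (pd₂ f (s, t)) t :=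
  HasFDerivAt.comp_hasDerivAt (f := fun t => (s, t)) t hf.hasFDerivAt
    ((hasDerivAt_const t s).prodMk (hasDerivAt_id t))

theorem ContDiff.pd₁ {m : ℕ} (hf : ContDiff ℝ (m + 1) f) : ContDiff ℝ m (pd₁ f) :=
  (hf.fderiv_right le_rfl).clm_apply contDiff_const

theorem ContDiff.pd₂ {m : ℕ} (hf : ContDiff ℝ (m + 1) f) : ContDiff ℝ m (pd₂ f) :=
  (hf.fderiv_right le_rfl).clm_apply contDiff_const

theorem pd₁_pd₂_comm (hf : ContDiff ℝ 2 f) (z : ℝ × ℝ) : pd₁ (pd₂ f) z = pd₂ (pd₁ f) z := by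
  have hd : DifferentiableAt ℝ (fderiv ℝ f) z :=
    ((hf.fderiv_right (m := 1) (by norm_num)).differentiable (by norm_num)) z
  have hs : IsSymmSndFDerivAt ℝ f z := hf.contDiffAt.isSymmSndFDerivAt (by simp)
  have key : ∀ v w : ℝ × ℝ,
      fderiv ℝ (fun y => fderiv ℝ f y v) z w = fderiv ℝ (fderiv ℝ f) z w v := by
    intro v w
    rw [fderiv_clm_apply hd (differentiableAt_const v)]
    simp
  calc pd₁ (pd₂ f) z = fderiv ℝ (fderiv ℝ f) z (1, 0) (0, 1) := key _ _
    _ = fderiv ℝ (fderiv ℝ f) z (0, 1) (1, 0) := hs _ _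
    _ = pd₂ (pd₁ f) z := (key _ _).symm

end Partial

/-- The first variation of the symplectic action of a family of loops. -/
theorem hasDerivAt_action {f : ℝ × ℝ → P n} (hf : ContDiff ℝ 2 f) {a b : ℝ}
    (hper : ∀ r, f (r, b) = f (r, a)) (r : ℝ) :
    HasDerivAt (fun r => ∫ θ in a..b, omegaN (f (r, θ)) (pd₂ f (r, θ)))
      (2 * ∫ θ in a..b, omegaN (pd₁ f (r, θ)) (pd₂ f (r, θ))) r := by
  have h1 : ContDiff ℝ 1 (pd₁ f) := ContDiff.pd₁ (m := 1) hf
  have h2 : ContDiff ℝ 1 (pd₂ f) := ContDiff.pd₂ (m := 1) hf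
  have c0 := hf.continuous
  have c1 := h1.continuous
  have c2 := h2.continuous
  have c12 : Continuous (pd₁ (pd₂ f)) := (ContDiff.pd₁ (m := 0) h2).continuous
  have d0 := hf.differentiable (by norm_num)
  have d1 := h1.differentiable (by norm_num)
  have d2 := h2.differentiable (by norm_num)
  have hmain := hasDerivAt_integral_param
    (F := fun r θ => omegaN (f (r, θ)) (pd₂ f (r, θ)))
    (F' := fun r θ => omegaN (pd₁ f (r, θ)) (pd₂ f (r, θ)) +
      omegaN (f (r, θ)) (pd₁ (pd₂ f) (r, θ))) a b
    (by simp only [Function.uncurry_def]; fun_prop) (by simp only [Function.uncurry_def]; fun_prop)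
    (fun s t => (hasDerivAt_pd₁ (d0 _)).omegaN (hasDerivAt_pd₁ (d2 _))) r
  refine hmain.congr_deriv ?_
  have hbd : ∫ θ in a..b, (omegaN (pd₂ f (r, θ)) (pd₁ f (r, θ)) +
      omegaN (f (r, θ)) (pd₁ (pd₂ f) (r, θ))) = 0 := by
    rw [intervalIntegral.integral_eq_sub_of_hasDerivAt
      (f := fun θ => omegaN (f (r, θ)) (pd₁ f (r, θ)))]
    · have : pd₁ f (r, b) = pd₁ f (r, a) := by
        have e := (hasDerivAt_pd₁ (s := r) (t := b) (d0 _)).deriv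
        rw [← e, ← (hasDerivAt_pd₁ (s := r) (t := a) (d0 _)).deriv]
        simp_rw [hper]
      rw [this, hper, sub_self]
    · intro θ _
      rw [pd₁_pd₂_comm hf]
      exact (hasDerivAt_pd₂ (d0 _)).omegaN (hasDerivAt_pd₂ (d1 _))
    · exact (show Continuous _ by fun_prop).intervalIntegrable _ _
  have hi : ∀ g : ℝ → ℝ, Continuous g → IntervalIntegrable g MeasureTheory.volume a b :=
    fun g hg => hg.intervalIntegrable _ _
  rw [intervalIntegral.integral_add (hi _ (by fun_prop)) (hi _ (by fun_prop))] at hbd ⊢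
  simp_rw [fun θ => omegaN_swap (pd₁ f (r, θ)) (pd₂ f (r, θ))] at hbd
  rw [intervalIntegral.integral_neg] at hbd
  linarith

/-- A crude isoperimetric inequality for loops. -/
theorem abs_action_le {w w' : ℝ → P n} {a b : ℝ} (hab : a < b)
    (hw : ∀ t, HasDerivAt w (w' t) t) (hw' : Continuous w') (hper : w b = w a) :
    |∫ t in a..b, omegaN (w t) (w' t)| ≤ 2 * (b - a) * ∫ t in a..b, ‖w' t‖ ^ 2 := by
  have hi : ∀ g : ℝ → ℝ, Continuous g → IntervalIntegrable g MeasureTheory.volume a b :=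
    fun g hg => hg.intervalIntegrable _ _
  have cw : Continuous w := continuous_iff_continuousAt.2 fun t => (hw t).continuousAt
  set L := ∫ t in a..b, ‖w' t‖ with hL
  have h0 : ∫ t in a..b, omegaN (w a) (w' t) = 0 := by
    rw [intervalIntegral.integral_eq_sub_of_hasDerivAt (f := fun t => omegaN (w a) (w t))
      (fun t _ => by
        have := (hasDerivAt_const t (w a)).omegaN (hw t)
        simpa [omegaN] using this) (hi _ (by fun_prop)), hper, sub_self]
  have h1 : ∫ t in a..b, omegaN (w t) (w' t) = ∫ t in a..b, omegaN (w t - w a) (w' t) := by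
    simp_rw [omegaN_sub_left]
    rw [intervalIntegral.integral_sub (hi _ (by fun_prop)) (hi _ (by fun_prop)), h0, sub_zero]
  have h2 : ∀ t ∈ Set.Icc a b, ‖w t - w a‖ ≤ L := by
    intro t ht
    rw [← intervalIntegral.integral_eq_sub_of_hasDerivAt (fun t _ => hw t)
      (hw'.intervalIntegrable _ _)]
    refine (intervalIntegral.norm_integral_le_integral_norm ht.1).trans ?_
    exact intervalIntegral.integral_mono_interval le_rfl ht.1 ht.2
      (Eventually.of_forall fun _ => norm_nonneg _) (hi _ (by fun_prop))
  have h3 : |∫ t in a..b, omegaN (w t - w a) (w' t)| ≤ ∫ t in a..b, 2 * L * ‖w' t‖ := by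
    rw [← Real.norm_eq_abs]
    refine (intervalIntegral.norm_integral_le_integral_norm hab.le).trans ?_
    refine intervalIntegral.integral_mono_on hab.le (hi _ (by fun_prop)) (hi _ (by fun_prop)) ?_
    intro t ht
    rw [Real.norm_eq_abs]
    refine (abs_omegaN_le _ _).trans ?_
    gcongr
    exact h2 t ht
  rw [intervalIntegral.integral_const_mul] at h3
  have h4 := sq_intervalIntegral_le (f := fun t => ‖w' t‖) (by fun_prop) hab
  rw [h1]
  rw [← hL] at h3 h4
  nlinarith

end Action

section Polar

open MeasureTheory Set

theorem integral_polar_le {G : ℝ × ℝ → ℝ} (hG : Continuous G) (hG0 : ∀ z, 0 ≤ G z)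
    (s₀ t₀ : ℝ) {R : ℝ} (hR : 0 < R) :
    ∫ r in (0 : ℝ)..R, r * ∫ θ in -Real.pi..Real.pi,
        G (s₀ + r * Real.cos θ, t₀ + r * Real.sin θ) ≤
      ∫ s in (s₀ - R)..(s₀ + R), ∫ t in (t₀ - R)..(t₀ + R), G (s, t) := by
  set D : Set (ℝ × ℝ) := {z | z.1 ^ 2 + z.2 ^ 2 ≤ R ^ 2} with hD
  have hDm : MeasurableSet D :=
    (isClosed_le (by fun_prop) (by fun_prop)).measurableSet
  set g : ℝ × ℝ → ℝ := fun z => G (s₀ + z.1, t₀ + z.2) with hg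
  have cg : Continuous g := by fun_prop
  set k : ℝ × ℝ → ℝ := fun p => p.1 * G (s₀ + p.1 * Real.cos p.2, t₀ + p.1 * Real.sin p.2) with hk
  have ck : Continuous k := by fun_prop
  have hpi : -Real.pi ≤ Real.pi := by linarith [Real.pi_pos]
  have e1 : ∫ r in (0 : ℝ)..R, r * ∫ θ in -Real.pi..Real.pi,
        G (s₀ + r * Real.cos θ, t₀ + r * Real.sin θ) =
      ∫ p in Ioc 0 R ×ˢ Ioo (-Real.pi) Real.pi, k p := by
    rw [Measure.volume_eq_prod, setIntegral_prod]
    · rw [intervalIntegral.integral_of_le hR.le]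
      refine setIntegral_congr_fun measurableSet_Ioc fun r _ => ?_
      simp only [hk]
      rw [integral_const_mul, intervalIntegral.integral_of_le hpi, integral_Ioc_eq_integral_Ioo]
    · exact (ck.continuousOn.integrableOn_compact
        ((isCompact_Icc (a := 0) (b := R)).prod
          (isCompact_Icc (a := -Real.pi) (b := Real.pi)))).mono_set
        (prod_mono Ioc_subset_Icc_self Ioo_subset_Icc_self)
  have e2 : ∫ p in Ioc 0 R ×ˢ Ioo (-Real.pi) Real.pi, k p =
      ∫ p in polarCoord.target, p.1 • D.indicator g (polarCoord.symm p) := by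
    have hset : Ioc 0 R ×ˢ Ioo (-Real.pi) Real.pi =
        polarCoord.target ∩ {p : ℝ × ℝ | p.1 ≤ R} := by
      ext p
      simp only [polarCoord_target, mem_prod, mem_Ioc, mem_Ioo, mem_inter_iff, mem_Ioi,
        mem_ofPred_eq]
      tauto
    have hm : MeasurableSet {p : ℝ × ℝ | p.1 ≤ R} :=
      (isClosed_le (by fun_prop) (by fun_prop)).measurableSet
    rw [hset, ← setIntegral_indicator hm]
    refine setIntegral_congr_fun polarCoord.open_target.measurableSet fun p hp => ?_
    have hp0 : 0 < p.1 := hp.1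
    have hiff : polarCoord.symm p ∈ D ↔ p.1 ≤ R := by
      simp only [hD, polarCoord_symm_apply, mem_ofPred_eq]
      rw [mul_pow, mul_pow, ← mul_add, Real.cos_sq_add_sin_sq, mul_one]
      exact sq_le_sq₀ hp0.le hR.le
    by_cases h : p.1 ≤ R
    · rw [indicator_of_mem (show p ∈ {p : ℝ × ℝ | p.1 ≤ R} from h), indicator_of_mem (hiff.2 h)]
      simp [hk, hg]
    · rw [indicator_of_notMem (show p ∉ {p : ℝ × ℝ | p.1 ≤ R} from h),
        indicator_of_notMem (fun h' => h (hiff.1 h')), smul_zero]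
  rw [e1, e2, integral_comp_polarCoord_symm, integral_indicator hDm]
  have hint : IntegrableOn g (Icc (-R) R ×ˢ Icc (-R) R) :=
    cg.continuousOn.integrableOn_compact (isCompact_Icc.prod isCompact_Icc)
  have hsub : D ⊆ Icc (-R) R ×ˢ Icc (-R) R := by
    intro z hz
    have hz : z.1 ^ 2 + z.2 ^ 2 ≤ R ^ 2 := hz
    exact ⟨abs_le.1 (abs_le_of_sq_le_sq (by nlinarith [sq_nonneg z.2]) hR.le),
      abs_le.1 (abs_le_of_sq_le_sq (by nlinarith [sq_nonneg z.1]) hR.le)⟩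
  refine (setIntegral_mono_set hint (Eventually.of_forall fun z => hG0 _)
    hsub.eventuallyLE).trans (le_of_eq ?_)
  rw [Measure.volume_eq_prod] at hint ⊢
  rw [setIntegral_prod _ hint]
  have hRR : -R ≤ R := by linarith
  calc ∫ x in Icc (-R) R, ∫ y in Icc (-R) R, g (x, y)
      = ∫ x in (-R)..R, ∫ y in (-R)..R, G (s₀ + x, t₀ + y) := by
        rw [intervalIntegral.integral_of_le hRR, integral_Icc_eq_integral_Ioc]
        refine setIntegral_congr_fun measurableSet_Ioc fun x _ => ?_
        simp only [hg]
        rw [intervalIntegral.integral_of_le hRR, integral_Icc_eq_integral_Ioc]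
    _ = ∫ x in (-R)..R, ∫ t in (t₀ - R)..(t₀ + R), G (s₀ + x, t) := by
        refine intervalIntegral.integral_congr fun x _ => ?_
        rw [intervalIntegral.integral_comp_add_left (fun t => G (s₀ + x, t)), ← sub_eq_add_neg]
    _ = _ := by
        rw [intervalIntegral.integral_comp_add_left
          (fun s => ∫ t in (t₀ - R)..(t₀ + R), G (s, t)), ← sub_eq_add_neg]

end Polar

section Local

variable {n : ℕ}

/-- A map of the plane in polar coordinates around the point `(s₀, t₀)`. -/
def polarMap {V : Type*} (u : ℝ × ℝ → V) (s₀ t₀ : ℝ) (z : ℝ × ℝ) : V :=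
  u (s₀ + z.1 * Real.cos z.2, t₀ + z.1 * Real.sin z.2)

section PolarMap

variable {V : Type*} [NormedAddCommGroup V] [NormedSpace ℝ V] {u : ℝ × ℝ → V} {s₀ t₀ : ℝ}

theorem ContDiff.polarMap {m : WithTop ℕ∞} (hu : ContDiff ℝ m u) :
    ContDiff ℝ m (polarMap u s₀ t₀) :=
  hu.comp ((contDiff_const.add (contDiff_fst.mul (Real.contDiff_cos.comp contDiff_snd))).prodMk
    (contDiff_const.add (contDiff_fst.mul (Real.contDiff_sin.comp contDiff_snd))))

theorem fderiv_apply_eq_pd (z : ℝ × ℝ) (a b : ℝ) :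
    fderiv ℝ u z (a, b) = a • pd₁ u z + b • pd₂ u z := by
  rw [pd₁, pd₂, ← map_smul, ← map_smul, ← map_add]; simp

theorem pd₁_polarMap (hu : Differentiable ℝ u) (hp : Differentiable ℝ (polarMap u s₀ t₀))
    (z : ℝ × ℝ) : pd₁ (polarMap u s₀ t₀) z =
      Real.cos z.2 • polarMap (pd₁ u) s₀ t₀ z + Real.sin z.2 • polarMap (pd₂ u) s₀ t₀ z := by
  refine (hasDerivAt_pd₁ (s := z.1) (t := z.2) (hp _)).unique ?_
  have h : HasDerivAt (fun r => (s₀ + r * Real.cos z.2, t₀ + r * Real.sin z.2))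
      (Real.cos z.2, Real.sin z.2) z.1 :=
    (((hasDerivAt_mul_const _).const_add _)).prodMk ((hasDerivAt_mul_const _).const_add _)
  have := HasFDerivAt.comp_hasDerivAt z.1 (hu _).hasFDerivAt h
  rw [fderiv_apply_eq_pd] at this
  exact this

theorem pd₂_polarMap (hu : Differentiable ℝ u) (hp : Differentiable ℝ (polarMap u s₀ t₀))
    (z : ℝ × ℝ) : pd₂ (polarMap u s₀ t₀) z =
      z.1 • (-Real.sin z.2 • polarMap (pd₁ u) s₀ t₀ z +
        Real.cos z.2 • polarMap (pd₂ u) s₀ t₀ z) := by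
  refine (hasDerivAt_pd₂ (s := z.1) (t := z.2) (hp _)).unique ?_
  have h : HasDerivAt (fun θ => (s₀ + z.1 * Real.cos θ, t₀ + z.1 * Real.sin θ))
      (z.1 * -Real.sin z.2, z.1 * Real.cos z.2) z.2 :=
    ((((Real.hasDerivAt_cos _).const_mul _).const_add _)).prodMk
      (((Real.hasDerivAt_sin _).const_mul _).const_add _)
  have := HasFDerivAt.comp_hasDerivAt z.2 (hu _).hasFDerivAt h
  rw [fderiv_apply_eq_pd, mul_smul, mul_smul, ← smul_add] at this
  exact this

end PolarMap

set_option maxHeartbeats 800000 in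
/-- Pointwise estimate at the centre of a disk in terms of its boundary circle. -/
theorem norm_le_circle {D μ R : ℝ} (hD : 0 ≤ D) (hμ : μ = 1 / (512 * Real.pi)) (hR : 0 < R)
    (hR1 : R ≤ 1) (hRsmall : R ^ μ * (2 * Real.pi * D + 128 * Real.pi / μ) ≤ 1)
    {u : ℝ × ℝ → P n} (hu : ContDiff ℝ 2 u) {B : ℝ} (hB : 0 ≤ B)
    (h : ∀ z, (‖pd₁ u z‖ ^ 2 + ‖pd₂ u z‖ ^ 2) / 64 - D * (1 + B) ^ 2 ≤
      -omegaN (pd₁ u z) (pd₂ u z)) (s₀ t₀ : ℝ) :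
    2 * Real.pi * ‖u (s₀, t₀)‖ ≤ B + 1 + 2 * Real.pi + 4 * Real.pi *
      ∫ θ in -Real.pi..Real.pi, polarMap
        (fun z => ‖u z‖ ^ 2 + (‖pd₁ u z‖ ^ 2 + ‖pd₂ u z‖ ^ 2)) s₀ t₀ (R, θ) := by
  have hpi := Real.pi_pos
  have hpi3 := Real.pi_gt_three
  have hpp : -Real.pi < Real.pi := by linarith
  have hμ0 : 0 < μ := by rw [hμ]; positivity
  have hμ1 : μ < 1 := by
    rw [hμ, div_lt_one (by positivity)]; linarith
  have hμK : 4 * Real.pi * μ = 1 / 128 := by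
    rw [hμ]; field_simp; norm_num
  set v := polarMap u s₀ t₀ with hv
  set vs := polarMap (pd₁ u) s₀ t₀ with hvs
  set vt := polarMap (pd₂ u) s₀ t₀ with hvt
  have hv2 : ContDiff ℝ 2 v := hu.polarMap
  have c0 : Continuous v := hv2.continuous
  have cs : Continuous vs :=
    (contDiff_zero.1 (((ContDiff.pd₁ (m := 1) hu).of_le (by norm_num)).polarMap))
  have ct : Continuous vt :=
    (contDiff_zero.1 (((ContDiff.pd₂ (m := 1) hu).of_le (by norm_num)).polarMap))
  have du := hu.differentiable (by norm_num)
  have dv := hv2.differentiable (by norm_num)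
  have h1 := pd₁_polarMap (s₀ := s₀) (t₀ := t₀) du dv
  have h2 := pd₂_polarMap (s₀ := s₀) (t₀ := t₀) du dv
  rw [← hv, ← hvs, ← hvt] at h1 h2
  have hi : ∀ g : ℝ → ℝ, Continuous g →
      IntervalIntegrable g MeasureTheory.volume (-Real.pi) Real.pi :=
    fun g hg => hg.intervalIntegrable _ _
  set N := D * (1 + B) ^ 2 with hN
  have hN0 : 0 ≤ N := by positivity
  set W : ℝ → ℝ := fun r => ∫ θ in -Real.pi..Real.pi, (‖vs (r, θ)‖ ^ 2 + ‖vt (r, θ)‖ ^ 2) with hW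
  have cW : Continuous W := continuous_integral_param _ _ (by
    simp only [Function.uncurry_def]; fun_prop)
  have hW0 : ∀ r, 0 ≤ W r := fun r =>
    intervalIntegral.integral_nonneg hpp.le fun _ _ => by positivity
  set b : ℝ → ℝ := fun r => -(∫ θ in -Real.pi..Real.pi, omegaN (v (r, θ)) (pd₂ v (r, θ))) / 2
    with hb
  set b' : ℝ → ℝ := fun r => -∫ θ in -Real.pi..Real.pi, omegaN (pd₁ v (r, θ)) (pd₂ v (r, θ))
    with hb'
  have cv1 : Continuous (pd₁ v) := (ContDiff.pd₁ (m := 1) hv2).continuous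
  have cv2 : Continuous (pd₂ v) := (ContDiff.pd₂ (m := 1) hv2).continuous
  have hper : ∀ r, v (r, Real.pi) = v (r, -Real.pi) := fun r => by simp [hv, polarMap]
  have hbd : ∀ r, HasDerivAt b (b' r) r := fun r => by
    refine ((hasDerivAt_action hv2 hper r).neg.div_const 2).congr_deriv ?_
    simp only [hb']; ring
  have hbW : ∀ r, |b r| ≤ 4 * Real.pi * r ^ 2 * W r := fun r => by
    have h3 := abs_action_le hpp (fun θ => hasDerivAt_pd₂ (dv (r, θ))) (by fun_prop) (hper r)
    have h4 : ∫ θ in -Real.pi..Real.pi, ‖pd₂ v (r, θ)‖ ^ 2 ≤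
        ∫ θ in -Real.pi..Real.pi, 2 * r ^ 2 * (‖vs (r, θ)‖ ^ 2 + ‖vt (r, θ)‖ ^ 2) := by
      refine intervalIntegral.integral_mono_on hpp.le (hi _ (by fun_prop)) (hi _ (by fun_prop)) ?_
      intro θ _
      rw [h2, norm_smul, mul_pow, Real.norm_eq_abs, sq_abs]
      have h5 : ‖-Real.sin θ • vs (r, θ) + Real.cos θ • vt (r, θ)‖ ≤
          ‖vs (r, θ)‖ + ‖vt (r, θ)‖ := by
        refine (norm_add_le _ _).trans ?_
        rw [norm_smul, norm_smul, norm_neg, Real.norm_eq_abs, Real.norm_eq_abs]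
        exact add_le_add (mul_le_of_le_one_left (norm_nonneg _) (Real.abs_sin_le_one _))
          (mul_le_of_le_one_left (norm_nonneg _) (Real.abs_cos_le_one _))
      have h6 := pow_le_pow_left₀ (norm_nonneg _) h5 2
      have h7 : (‖vs (r, θ)‖ + ‖vt (r, θ)‖) ^ 2 ≤ 2 * (‖vs (r, θ)‖ ^ 2 + ‖vt (r, θ)‖ ^ 2) := by
        nlinarith [sq_nonneg (‖vs (r, θ)‖ - ‖vt (r, θ)‖)]
      have h8 := mul_le_mul_of_nonneg_left (h6.trans h7) (sq_nonneg r)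
      simp only at h8 ⊢
      linarith
    rw [intervalIntegral.integral_const_mul] at h4
    simp only [hb]
    rw [abs_div, abs_neg, abs_two]
    have h9 := mul_le_mul_of_nonneg_left h4 (by linarith : 0 ≤ 2 * (Real.pi - -Real.pi))
    simp only [hW]
    linarith
  have hb'W : ∀ r, 0 ≤ r → r * (W r / 64 - 2 * Real.pi * N) ≤ b' r := fun r hr => by
    have e : ∀ θ, omegaN (pd₁ v (r, θ)) (pd₂ v (r, θ)) =
        r * omegaN (vs (r, θ)) (vt (r, θ)) := fun θ => by
      rw [h1, h2]
      simp only [omegaN_smul_right, omegaN_smul_left, omegaN_add_left, omegaN_add_right,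
        omegaN_self, omegaN_swap (vs (r, θ)) (vt (r, θ))]
      linear_combination r * omegaN (vs (r, θ)) (vt (r, θ)) * Real.sin_sq_add_cos_sq θ
    simp only [hb', e]
    rw [intervalIntegral.integral_const_mul, ← mul_neg, ← intervalIntegral.integral_neg]
    refine mul_le_mul_of_nonneg_left ?_ hr
    have h3 : ∫ θ in -Real.pi..Real.pi, ((‖vs (r, θ)‖ ^ 2 + ‖vt (r, θ)‖ ^ 2) / 64 - N) ≤
        ∫ θ in -Real.pi..Real.pi, -omegaN (vs (r, θ)) (vt (r, θ)) :=
      intervalIntegral.integral_mono_on hpp.le (hi _ (by fun_prop)) (hi _ (by fun_prop))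
        fun θ _ => h _
    rw [intervalIntegral.integral_sub (hi _ (by fun_prop)) (hi _ (by fun_prop)),
      intervalIntegral.integral_div, intervalIntegral.integral_const, smul_eq_mul] at h3
    simp only [hW]
    linarith
  set m : ℝ → P n := fun r => ∫ θ in -Real.pi..Real.pi, v (r, θ) with hm
  have cm : Continuous m := continuous_integral_param _ _ (by
    simp only [Function.uncurry_def]; fun_prop)
  have hmd : ∀ r, HasDerivAt m (∫ θ in -Real.pi..Real.pi, pd₁ v (r, θ)) r :=
    hasDerivAt_integral_param _ _ (by simp only [Function.uncurry_def]; fun_prop)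
      (by simp only [Function.uncurry_def]; fun_prop) (fun r θ => hasDerivAt_pd₁ (dv _))
  have hB1 : 0 < 1 + B := by linarith
  set l := (1 + B)⁻¹ with hl
  have hl0 : 0 < l := inv_pos.2 hB1
  have hl1 : l ≤ 1 := inv_le_one_of_one_le₀ (by linarith)
  have hlB : l * (1 + B) = 1 := inv_mul_cancel₀ hB1.ne'
  set ψ : ℝ → ℝ := fun r => l * (r ^ (-μ) * b r) + l * (2 * Real.pi * N) * (r ^ (2 - μ) / (2 - μ))
    + 128 * Real.pi / l * (r ^ μ / μ) with hψ
  have hψd : ∀ r, 0 < r → HasDerivAt ψ (l * (-μ * r ^ (-μ - 1) * b r + r ^ (-μ) * b' r) +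
      l * (2 * Real.pi * N) * ((2 - μ) * r ^ (2 - μ - 1) / (2 - μ)) +
      128 * Real.pi / l * (μ * r ^ (μ - 1) / μ)) r := fun r hr =>
    (((((Real.hasDerivAt_rpow_const (Or.inl hr.ne')).mul (hbd r)).const_mul l).add
      (((Real.hasDerivAt_rpow_const (Or.inl hr.ne')).div_const _).const_mul _))).add
      (((Real.hasDerivAt_rpow_const (Or.inl hr.ne')).div_const _).const_mul _)
  have hψm : ∀ r, 0 < r → ‖∫ θ in -Real.pi..Real.pi, pd₁ v (r, θ)‖ ≤
      l * (-μ * r ^ (-μ - 1) * b r + r ^ (-μ) * b' r) +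
      l * (2 * Real.pi * N) * ((2 - μ) * r ^ (2 - μ - 1) / (2 - μ)) +
      128 * Real.pi / l * (μ * r ^ (μ - 1) / μ) := fun r hr => by
    set x := r ^ (-μ) with hx
    have hx0 : 0 < x := Real.rpow_pos_of_pos hr _
    have e1 : r ^ (-μ - 1) = x / r := by rw [Real.rpow_sub_one hr.ne']
    have e2 : r ^ (2 - μ - 1) = x * r := by
      rw [show (2 - μ - 1) = -μ + 1 by ring, Real.rpow_add_one hr.ne']
    have e3 : r ^ (μ - 1) = 1 / (x * r) := by
      rw [Real.rpow_sub_one hr.ne', hx, Real.rpow_neg hr.le]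
      have := (Real.rpow_pos_of_pos hr μ).ne'
      field_simp
    rw [e1, e2, e3, mul_div_cancel_left₀ _ (by linarith : (2 - μ) ≠ 0),
      mul_div_cancel_left₀ _ hμ0.ne']
    set y := l * (x * r) with hy
    have hy0 : 0 < y := by positivity
    have f1 : ‖∫ θ in -Real.pi..Real.pi, pd₁ v (r, θ)‖ ≤ y * W r / 128 + 128 * Real.pi / y := by
      refine (intervalIntegral.norm_integral_le_integral_norm hpp.le).trans ?_
      have f2 : ∫ θ in -Real.pi..Real.pi, ‖pd₁ v (r, θ)‖ ≤ ∫ θ in -Real.pi..Real.pi,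
          (y / 128 * (‖vs (r, θ)‖ ^ 2 + ‖vt (r, θ)‖ ^ 2) + 64 / y) := by
        refine intervalIntegral.integral_mono_on hpp.le (hi _ (by fun_prop))
          (hi _ (by fun_prop)) ?_
        intro θ _
        have f3 : ‖pd₁ v (r, θ)‖ ≤ ‖vs (r, θ)‖ + ‖vt (r, θ)‖ := by
          rw [h1]
          refine (norm_add_le _ _).trans ?_
          rw [norm_smul, norm_smul, Real.norm_eq_abs, Real.norm_eq_abs]
          exact add_le_add (mul_le_of_le_one_left (norm_nonneg _) (Real.abs_cos_le_one _))
            (mul_le_of_le_one_left (norm_nonneg _) (Real.abs_sin_le_one _))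
        have f4 : ∀ c : ℝ, c ≤ y / 128 * c ^ 2 + 32 / y := fun c => by
          have : y / 128 * c ^ 2 + 32 / y - c = y / 128 * (c - 64 / y) ^ 2 := by
            field_simp; ring
          have f5 : 0 ≤ y / 128 * (c - 64 / y) ^ 2 := by positivity
          linarith
        have f6 := f4 ‖vs (r, θ)‖
        have f7 := f4 ‖vt (r, θ)‖
        have f8 : 64 / y = 32 / y + 32 / y := by ring
        rw [f8]
        linarith
      rw [intervalIntegral.integral_add (hi _ (by fun_prop)) (hi _ (by fun_prop)),
        intervalIntegral.integral_const_mul, intervalIntegral.integral_const, smul_eq_mul] at f2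
      refine f2.trans (le_of_eq ?_)
      simp only [hW]; ring
    refine f1.trans ?_
    have g1 := hb'W r hr.le
    have g2 : -(W r * r / 128) ≤ -μ / r * b r := by
      have := (abs_le.1 (hbW r)).2
      have g3 : μ / r * b r ≤ μ / r * (4 * Real.pi * r ^ 2 * W r) :=
        mul_le_mul_of_nonneg_left this (by positivity)
      have g4 : μ / r * (4 * Real.pi * r ^ 2 * W r) = (4 * Real.pi * μ) * (W r * r) := by
        field_simp
      rw [g4, hμK] at g3
      have g5 : -μ / r * b r = -(μ / r * b r) := by ring
      rw [g5]; linarith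
    have g6 : l * x * (-(W r * r / 128) + r * (W r / 64 - 2 * Real.pi * N)) ≤
        l * x * (-μ / r * b r + b' r) := mul_le_mul_of_nonneg_left (by linarith) (by positivity)
    have g7 : 128 * Real.pi / l * (1 / (x * r)) = 128 * Real.pi / y := by
      rw [hy]; field_simp
    have g8 : l * (-μ * (x / r) * b r + x * b' r) = l * x * (-μ / r * b r + b' r) := by
      field_simp
    rw [g7, g8]
    have g9 : l * x * (-(W r * r / 128) + r * (W r / 64 - 2 * Real.pi * N)) =
        y * W r / 128 - l * (2 * Real.pi * N) * (x * r) := by rw [hy]; ring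
    linarith
  have hmδ : ∀ δ ∈ Set.Ioo 0 R,
      ‖m R - m δ‖ ≤ ψ R + 4 * Real.pi * l * δ ^ (2 - μ) * W δ := by
    intro δ hδ
    have k1 := image_norm_le_of_norm_deriv_right_le_deriv_boundary' (a := δ) (b := R)
      (f := fun r => m r - m δ) (B := fun r => ψ r - ψ δ)
      (f' := fun r => ∫ θ in -Real.pi..Real.pi, pd₁ v (r, θ))
      (by fun_prop) (fun r _ => ((hmd r).sub_const _).hasDerivWithinAt) (by simp)
      (fun r hr => ((hψd r (hδ.1.trans_le hr.1)).sub_const _).continuousAt.continuousWithinAt)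
      (fun r hr => ((hψd r (hδ.1.trans_le hr.1)).sub_const _).hasDerivWithinAt)
      (fun r hr => hψm r (hδ.1.trans_le hr.1)) (Set.right_mem_Icc.2 hδ.2.le)
    refine k1.trans ?_
    have k2 : δ ^ (-μ) * (-b δ) ≤ δ ^ (-μ) * (4 * Real.pi * δ ^ 2 * W δ) :=
      mul_le_mul_of_nonneg_left (by linarith [(abs_le.1 (hbW δ)).1])
        (Real.rpow_pos_of_pos hδ.1 _).le
    have k3 : δ ^ (2 - μ) = δ ^ (-μ) * δ ^ 2 := by
      rw [show (2 - μ) = -μ + (2 : ℕ) by push_cast; ring, Real.rpow_add_natCast hδ.1.ne']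
    have k4 := mul_le_mul_of_nonneg_left k2 hl0.le
    have k5 : 0 ≤ l * (2 * Real.pi * N) * (δ ^ (2 - μ) / (2 - μ)) :=
      mul_nonneg (by positivity) (div_nonneg (Real.rpow_nonneg hδ.1.le _) (by linarith))
    have k6 : 0 ≤ 128 * Real.pi / l * (δ ^ μ / μ) :=
      mul_nonneg (by positivity) (div_nonneg (Real.rpow_nonneg hδ.1.le _) hμ0.le)
    have k7 : ψ δ = l * (δ ^ (-μ) * b δ) + l * (2 * Real.pi * N) * (δ ^ (2 - μ) / (2 - μ))
      + 128 * Real.pi / l * (δ ^ μ / μ) := rfl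
    rw [k3]
    linarith
  have hm0 : ‖m R - m 0‖ ≤ ψ R := by
    have cr : Continuous fun δ : ℝ => δ ^ (2 - μ) :=
      Real.continuous_rpow_const (by linarith)
    have l1 : Continuous fun δ => ψ R + 4 * Real.pi * l * δ ^ (2 - μ) * W δ := by fun_prop
    have l2 : Continuous fun δ => ‖m R - m δ‖ := by fun_prop
    have t1 := (l1.tendsto 0).mono_left (nhdsWithin_le_nhds (s := Set.Ioi 0))
    have t2 := (l2.tendsto 0).mono_left (nhdsWithin_le_nhds (s := Set.Ioi 0))
    have := le_of_tendsto_of_tendsto t2 t1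
      (eventually_of_mem (Ioo_mem_nhdsGT hR) hmδ)
    rwa [Real.zero_rpow (by linarith), mul_zero, zero_mul, add_zero] at this
  have hm00 : m 0 = (2 * Real.pi) • u (s₀, t₀) := by
    simp only [hm, hv, polarMap, zero_mul, add_zero]
    rw [intervalIntegral.integral_const]
    congr 1; ring
  have hmR : ‖m R‖ ≤ 2 * Real.pi + ∫ θ in -Real.pi..Real.pi, ‖v (R, θ)‖ ^ 2 := by
    refine (intervalIntegral.norm_integral_le_integral_norm hpp.le).trans ?_
    have : ∫ θ in -Real.pi..Real.pi, ‖v (R, θ)‖ ≤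
        ∫ θ in -Real.pi..Real.pi, (1 + ‖v (R, θ)‖ ^ 2) :=
      intervalIntegral.integral_mono_on hpp.le (hi _ (by fun_prop)) (hi _ (by fun_prop))
        fun θ _ => by nlinarith [sq_nonneg (‖v (R, θ)‖ - 1), sq_nonneg ‖v (R, θ)‖]
    rw [intervalIntegral.integral_add (hi _ (by fun_prop)) (hi _ (by fun_prop)),
      intervalIntegral.integral_const, smul_eq_mul] at this
    linarith
  have hψR : ψ R ≤ 4 * Real.pi * W R + (1 + B) := by
    have q0 : R ^ (2 - μ) ≤ R ^ μ := Real.rpow_le_rpow_of_exponent_ge hR hR1 (by linarith)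
    have q1 : R ^ (2 - μ) ≤ 1 := Real.rpow_le_one hR.le hR1 (by linarith)
    have q2 : R ^ (2 - μ) = R ^ (-μ) * R ^ 2 := by
      rw [show (2 - μ) = -μ + (2 : ℕ) by push_cast; ring, Real.rpow_add_natCast hR.ne']
    have q3 : R ^ (-μ) * b R ≤ 4 * Real.pi * W R := by
      have := mul_le_mul_of_nonneg_left (abs_le.1 (hbW R)).2 (Real.rpow_nonneg hR.le (-μ))
      have q4 : R ^ (-μ) * (4 * Real.pi * R ^ 2 * W R) = R ^ (2 - μ) * (4 * Real.pi * W R) := by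
        rw [q2]; ring
      rw [q4] at this
      exact this.trans (mul_le_of_le_one_left (mul_nonneg (by positivity) (hW0 R)) q1)
    have q5 : l * (R ^ (-μ) * b R) ≤ 4 * Real.pi * W R :=
      (mul_le_mul_of_nonneg_left q3 hl0.le).trans
        (mul_le_of_le_one_left (mul_nonneg (by positivity) (hW0 R)) hl1)
    have q6 : R ^ (2 - μ) / (2 - μ) ≤ R ^ μ :=
      (div_le_self (Real.rpow_nonneg hR.le _) (by linarith)).trans q0
    have q7 : l * (2 * Real.pi * N) = 2 * Real.pi * D * (1 + B) := by
      rw [hN]; linear_combination 2 * Real.pi * D * (1 + B) * hlB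
    have q8 : 128 * Real.pi / l = 128 * Real.pi * (1 + B) := by
      rw [hl, div_inv_eq_mul]
    have q9 : 2 * Real.pi * D * (1 + B) * (R ^ (2 - μ) / (2 - μ)) ≤
        2 * Real.pi * D * (1 + B) * R ^ μ := mul_le_mul_of_nonneg_left q6 (by positivity)
    have q10 := mul_le_mul_of_nonneg_left hRsmall hB1.le
    have q11 : (1 + B) * (R ^ μ * (2 * Real.pi * D + 128 * Real.pi / μ)) =
        2 * Real.pi * D * (1 + B) * R ^ μ + 128 * Real.pi * (1 + B) * (R ^ μ / μ) := by ring
    simp only [hψ]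
    rw [q7, q8]
    linarith
  have hfin : 2 * Real.pi * ‖u (s₀, t₀)‖ ≤ ‖m R‖ + ‖m R - m 0‖ := by
    have : ‖m 0‖ = 2 * Real.pi * ‖u (s₀, t₀)‖ := by
      rw [hm00, norm_smul, Real.norm_eq_abs, abs_of_pos (by positivity)]
    rw [← this]
    have := norm_sub_le (m R) (m R - m 0)
    simpa using this
  have hG : ∫ θ in -Real.pi..Real.pi, polarMap
        (fun z => ‖u z‖ ^ 2 + (‖pd₁ u z‖ ^ 2 + ‖pd₂ u z‖ ^ 2)) s₀ t₀ (R, θ) =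
      (∫ θ in -Real.pi..Real.pi, ‖v (R, θ)‖ ^ 2) + W R :=
    intervalIntegral.integral_add (hi (fun θ => ‖v (R, θ)‖ ^ 2) (by fun_prop))
      (hi (fun θ => ‖vs (R, θ)‖ ^ 2 + ‖vt (R, θ)‖ ^ 2) (by fun_prop))
  have hv0 : 0 ≤ ∫ θ in -Real.pi..Real.pi, ‖v (R, θ)‖ ^ 2 :=
    intervalIntegral.integral_nonneg hpp.le fun _ _ => by positivity
  have hv1 : (∫ θ in -Real.pi..Real.pi, ‖v (R, θ)‖ ^ 2) ≤
      4 * Real.pi * ∫ θ in -Real.pi..Real.pi, ‖v (R, θ)‖ ^ 2 :=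
    le_mul_of_one_le_left hv0 (by linarith)
  rw [hG, mul_add]
  linarith

end Local

section LocalBound

variable {n : ℕ}

/-- Local sup estimate: an approximately `J`-holomorphic map is controlled at a point by its
`W^{1,2}`-norm on a small square, up to an absorbable fraction of its sup norm. -/
theorem exists_norm_le_local (n : ℕ) {D : ℝ} (hD : 0 ≤ D) :
    ∃ R K : ℝ, 0 < R ∧ R ≤ 1 / 2 ∧ 0 ≤ K ∧ ∀ u : ℝ × ℝ → P n, ContDiff ℝ 2 u → ∀ B : ℝ, 0 ≤ B →
      (∀ z, (‖pd₁ u z‖ ^ 2 + ‖pd₂ u z‖ ^ 2) / 64 - D * (1 + B) ^ 2 ≤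
        -omegaN (pd₁ u z) (pd₂ u z)) →
      ∀ s₀ t₀, ‖u (s₀, t₀)‖ ≤ B / 2 + K * (1 + ∫ s in (s₀ - R)..(s₀ + R),
        ∫ t in (t₀ - R)..(t₀ + R),
          (‖u (s, t)‖ ^ 2 + (‖pd₁ u (s, t)‖ ^ 2 + ‖pd₂ u (s, t)‖ ^ 2))) := by
  have hpi := Real.pi_pos
  have hpi3 := Real.pi_gt_three
  set μ : ℝ := 1 / (512 * Real.pi) with hμ
  have hμ0 : 0 < μ := by positivity
  set c := 2 * Real.pi * D + 128 * Real.pi / μ with hc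
  have hc0 : 0 ≤ c := by positivity
  obtain ⟨R, hR, hR0, hR2⟩ : ∃ R : ℝ, R ^ μ * c ≤ 1 ∧ 0 < R ∧ R < 1 / 2 := by
    have ht : Tendsto (fun r : ℝ => r ^ μ * c) (nhdsWithin 0 (Set.Ioi 0)) (nhds 0) := by
      have := ((Real.continuous_rpow_const hμ0.le).mul continuous_const).tendsto
        (x := (0 : ℝ)) (f := fun r : ℝ => r ^ μ * c)
      rw [Real.zero_rpow hμ0.ne', zero_mul] at this
      exact this.mono_left nhdsWithin_le_nhds
    have h1 := ht.eventually (gt_mem_nhds one_pos)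
    have h2 : ∀ᶠ r : ℝ in nhdsWithin 0 (Set.Ioi 0), r ∈ Set.Ioo (0 : ℝ) (1 / 2) :=
      Ioo_mem_nhdsGT (by norm_num)
    obtain ⟨R, h3, h4⟩ := (h1.and h2).exists
    exact ⟨R, h3.le, h4.1, h4.2⟩
  refine ⟨R, 4 / R ^ 2 + 2, hR0, hR2.le, by positivity, fun u hu B hB h s₀ t₀ => ?_⟩
  set G : ℝ × ℝ → ℝ := fun z => ‖u z‖ ^ 2 + (‖pd₁ u z‖ ^ 2 + ‖pd₂ u z‖ ^ 2) with hG
  have c1 : Continuous (pd₁ u) := (ContDiff.pd₁ (m := 1) hu).continuous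
  have c2 : Continuous (pd₂ u) := (ContDiff.pd₂ (m := 1) hu).continuous
  have c0 := hu.continuous
  have cG : Continuous G := by fun_prop
  have hG0 : ∀ z, 0 ≤ G z := fun z => by positivity
  set I := ∫ s in (s₀ - R)..(s₀ + R), ∫ t in (t₀ - R)..(t₀ + R), G (s, t) with hI
  have hI0 : 0 ≤ I := intervalIntegral.integral_nonneg (by linarith) fun s _ =>
    intervalIntegral.integral_nonneg (by linarith) fun t _ => hG0 _
  have hpol := integral_polar_le cG hG0 s₀ t₀ hR0
  set m := 2 * Real.pi * ‖u (s₀, t₀)‖ - (B + 1 + 2 * Real.pi) with hm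
  have cpol : Continuous fun r => ∫ θ in -Real.pi..Real.pi,
      G (s₀ + r * Real.cos θ, t₀ + r * Real.sin θ) :=
    continuous_integral_param _ _ (by simp only [Function.uncurry_def]; fun_prop)
  have hle : ∫ r in (0 : ℝ)..R, r * m ≤ ∫ r in (0 : ℝ)..R, 4 * Real.pi *
      (r * ∫ θ in -Real.pi..Real.pi, G (s₀ + r * Real.cos θ, t₀ + r * Real.sin θ)) := by
    refine intervalIntegral.integral_mono_on_of_le_Ioo hR0.le
      ((by fun_prop : Continuous fun r : ℝ => r * m).intervalIntegrable _ _)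
      ((by fun_prop : Continuous fun r : ℝ => 4 * Real.pi * (r * ∫ θ in -Real.pi..Real.pi,
        G (s₀ + r * Real.cos θ, t₀ + r * Real.sin θ))).intervalIntegrable _ _) ?_
    intro r hr
    have hrμ : r ^ μ * c ≤ 1 := (mul_le_mul_of_nonneg_right
      (Real.rpow_le_rpow hr.1.le hr.2.le hμ0.le) hc0).trans hR
    have h5 := norm_le_circle hD hμ hr.1 (by linarith [hr.2]) hrμ hu hB h s₀ t₀
    have h6 : m ≤ 4 * Real.pi * ∫ θ in -Real.pi..Real.pi,
        G (s₀ + r * Real.cos θ, t₀ + r * Real.sin θ) := sub_le_iff_le_add'.2 h5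
    have h7 := mul_le_mul_of_nonneg_left h6 hr.1.le
    linarith
  rw [intervalIntegral.integral_const_mul, intervalIntegral.integral_mul_const, integral_id] at hle
  have h8 : (R ^ 2 - 0 ^ 2) / 2 * m ≤ 4 * Real.pi * I :=
    hle.trans (mul_le_mul_of_nonneg_left hpol (by positivity))
  have h9 : m ≤ 8 * Real.pi / R ^ 2 * I := by
    have : 8 * Real.pi / R ^ 2 * I = (4 * Real.pi * I) / (R ^ 2 / 2) := by field_simp; ring
    rw [this, le_div_iff₀ (by positivity)]
    linarith
  have h10 : 2 * Real.pi * ‖u (s₀, t₀)‖ ≤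
      2 * Real.pi * (B / 2 + (4 / R ^ 2 + 2) * (1 + I)) := by
    have e : 2 * Real.pi * (B / 2 + (4 / R ^ 2 + 2) * (1 + I)) =
        Real.pi * B + 8 * Real.pi / R ^ 2 * I + (8 * Real.pi / R ^ 2 + 4 * Real.pi)
          + 4 * Real.pi * I := by
      field_simp; ring
    have q1 : B ≤ Real.pi * B := le_mul_of_one_le_left hB (by linarith)
    have q2 : 0 ≤ 8 * Real.pi / R ^ 2 := by positivity
    have q3 : 0 ≤ 4 * Real.pi * I := by positivity
    rw [e]
    linarith
  exact le_of_mul_le_mul_left h10 (by positivity)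

end LocalBound

section Periodic

variable {n : ℕ}

/-- Invertibility of `d/dt - 2 a Jstd` on loops, with an explicit bound degenerating
at the resonances `a ∈ πℤ`. -/
theorem abs_sin_mul_norm_le {w w' : ℝ → P n} (a : ℝ) (hw : ∀ t, HasDerivAt w (w' t) t)
    (hw' : Continuous w') (hper : ∀ t, w (t + 1) = w t) (t : ℝ) :
    |Real.sin a| * ‖w t‖ ≤ 2 * ∫ τ in (0 : ℝ)..1, ‖w' τ - (2 * a) • Jstd n (w τ)‖ := by
  have cw : Continuous w := continuous_iff_continuousAt.2 fun t => (hw t).continuousAt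
  have rot : ∀ (c s : ℝ) (z : P n), |c| ≤ 1 → |s| ≤ 1 → ‖c • z - s • Jstd n z‖ ≤ 2 * ‖z‖ := by
    intro c s z hc hs
    refine (norm_sub_le _ _).trans ?_
    rw [norm_smul, norm_smul, norm_Jstd_apply, Real.norm_eq_abs, Real.norm_eq_abs]
    nlinarith [norm_nonneg z]
  set k : ℝ → P n := fun τ => w' τ - (2 * a) • Jstd n (w τ) with hk
  have ck : Continuous k := by fun_prop
  have hk_per : Function.Periodic (fun τ => ‖k τ‖) 1 := fun τ => by
    have h1 : w' (τ + 1) = w' τ := by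
      have := (hw (τ + 1)).comp_add_const τ 1
      simp_rw [hper] at this
      exact this.unique (hw τ)
    simp only [hk, h1, hper]
  set y : ℝ → P n := fun τ =>
    Real.cos (2 * a * (τ - t)) • w τ - Real.sin (2 * a * (τ - t)) • Jstd n (w τ) with hy
  have hyd : ∀ τ, HasDerivAt y (Real.cos (2 * a * (τ - t)) • k τ -
      Real.sin (2 * a * (τ - t)) • Jstd n (k τ)) τ := fun τ => by
    have l : HasDerivAt (fun τ => 2 * a * (τ - t)) (2 * a) τ := by
      simpa using ((hasDerivAt_id τ).sub_const t).const_mul (2 * a)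
    have hJ : HasDerivAt (fun τ => Jstd n (w τ)) (Jstd n (w' τ)) τ :=
      (Jstd n).hasFDerivAt.comp_hasDerivAt τ (hw τ)
    refine ((l.cos.smul (hw τ)).sub (l.sin.smul hJ)).congr_deriv ?_
    simp only [hk, map_sub, map_smul, Jstd_Jstd]
    module
  have hint : ‖y (t + 1) - y t‖ ≤ 2 * ∫ τ in (0 : ℝ)..1, ‖k τ‖ := by
    rw [← intervalIntegral.integral_eq_sub_of_hasDerivAt (fun τ _ => hyd τ)
      ((by fun_prop : Continuous fun τ => Real.cos (2 * a * (τ - t)) • k τ -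
      Real.sin (2 * a * (τ - t)) • Jstd n (k τ)).intervalIntegrable _ _)]
    refine (intervalIntegral.norm_integral_le_integral_norm (by linarith)).trans ?_
    have e : ∫ τ in (0 : ℝ)..1, ‖k τ‖ = ∫ τ in t..(t + 1), ‖k τ‖ := by
      have := hk_per.intervalIntegral_add_eq 0 t
      simpa using this
    rw [e, ← intervalIntegral.integral_const_mul]
    exact intervalIntegral.integral_mono_on (by linarith)
      ((by fun_prop : Continuous fun τ => ‖Real.cos (2 * a * (τ - t)) • k τ -
      Real.sin (2 * a * (τ - t)) • Jstd n (k τ)‖).intervalIntegrable _ _)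
      ((by fun_prop : Continuous fun τ => 2 * ‖k τ‖).intervalIntegrable _ _)
      fun τ _ => rot _ _ _ (Real.abs_cos_le_one _) (Real.abs_sin_le_one _)
  have hq : y (t + 1) - y t =
      (-2 * Real.sin a) • (Real.sin a • w t + Real.cos a • Jstd n (w t)) := by
    simp only [hy, hper, add_sub_cancel_left, sub_self, mul_one, mul_zero, Real.cos_zero,
      Real.sin_zero, Real.cos_two_mul, Real.sin_two_mul, Real.cos_sq' a]
    module
  have hq2 : Real.sin a • (y (t + 1) - y t) - Real.cos a • Jstd n (y (t + 1) - y t) =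
      (-2 * Real.sin a) • w t := by
    rw [hq]
    simp only [map_smul, map_add, Jstd_Jstd]
    match_scalars
    · linear_combination -2 * Real.sin a * Real.sin_sq_add_cos_sq a
    · ring
  have hfin := rot (Real.sin a) (Real.cos a) (y (t + 1) - y t) (Real.abs_sin_le_one _)
    (Real.abs_cos_le_one _)
  rw [hq2, norm_smul, Real.norm_eq_abs, abs_mul, abs_neg, abs_two] at hfin
  linarith

theorem sin_sq_mul_integral_le {w w' : ℝ → P n} (a : ℝ) (hw : ∀ t, HasDerivAt w (w' t) t)
    (hw' : Continuous w') (hper : ∀ t, w (t + 1) = w t) :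
    Real.sin a ^ 2 * ∫ t in (0 : ℝ)..1, ‖w t‖ ^ 2 ≤
      4 * ∫ τ in (0 : ℝ)..1, ‖w' τ - (2 * a) • Jstd n (w τ)‖ ^ 2 := by
  have cw : Continuous w := continuous_iff_continuousAt.2 fun t => (hw t).continuousAt
  have hcs := sq_intervalIntegral_le (f := fun τ => ‖w' τ - (2 * a) • Jstd n (w τ)‖)
    (by fun_prop) (zero_lt_one' ℝ)
  set I := ∫ τ in (0 : ℝ)..1, ‖w' τ - (2 * a) • Jstd n (w τ)‖ with hI
  have h : ∫ t in (0 : ℝ)..1, Real.sin a ^ 2 * ‖w t‖ ^ 2 ≤ ∫ _ in (0 : ℝ)..1, 4 * I ^ 2 := by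
    refine intervalIntegral.integral_mono_on zero_le_one
      ((by fun_prop : Continuous fun t => Real.sin a ^ 2 * ‖w t‖ ^ 2).intervalIntegrable _ _)
      intervalIntegrable_const fun t _ => ?_
    have := pow_le_pow_left₀ (by positivity) (abs_sin_mul_norm_le a hw hw' hper t) 2
    rw [mul_pow, sq_abs, mul_pow] at this
    linarith
  rw [intervalIntegral.integral_const_mul, intervalIntegral.integral_const, smul_eq_mul] at h
  linarith

end Periodic

section Energy

variable {n : ℕ} {H : ℝ → ℝ → P n → ℝ} {u : ℝ × ℝ → P n}

/-- The Hamiltonian action of the loop `u(s,·)`. -/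
def floerAction (H : ℝ → ℝ → P n → ℝ) (u : ℝ × ℝ → P n) (s : ℝ) : ℝ :=
  (∫ t in (0 : ℝ)..1, omegaN (u (s, t)) (pd₂ u (s, t))) / 2 -
    ∫ t in (0 : ℝ)..1, H s t (u (s, t))

theorem fderiv_hamiltonian (hH : ContDiff ℝ 1 (fun z : ℝ × ℝ × P n => H z.1 z.2.1 z.2.2))
    (s t : ℝ) (z ξ : P n) :
    fderiv ℝ (fun z : ℝ × ℝ × P n => H z.1 z.2.1 z.2.2) (s, t, z) (1, 0, ξ) =
      deriv (fun s' => H s' t z) s + omegaN ξ (XH (H s t) z) := by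
  have hd := (hH.differentiable one_ne_zero (s, t, z)).hasFDerivAt
  have h1 : HasDerivAt (fun s' => H s' t z) _ s :=
    HasFDerivAt.comp_hasDerivAt (f := fun s' : ℝ => (s', t, z)) s hd
      ((hasDerivAt_id s).prodMk (hasDerivAt_const s (t, z)))
  have h2 : HasFDerivAt (H s t) _ z :=
    HasFDerivAt.comp (f := fun w : P n => (s, t, w)) z hd
      ((hasFDerivAt_const s z).prodMk ((hasFDerivAt_const t z).prodMk (hasFDerivAt_id z)))
  rw [h1.deriv, omegaN_XH h2.differentiableAt, h2.fderiv]
  have e : ((1 : ℝ), (0 : ℝ), ξ) = (1, 0, 0) + (0, 0, ξ) := by simp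
  rw [e, map_add]
  rfl

theorem continuous_deriv_hamiltonian
    (hH : ContDiff ℝ 1 (fun z : ℝ × ℝ × P n => H z.1 z.2.1 z.2.2)) (hu : Continuous u) :
    Continuous fun p : ℝ × ℝ => deriv (fun s' => H s' p.2 (u p)) p.1 := by
  have h : ∀ p : ℝ × ℝ, deriv (fun s' => H s' p.2 (u p)) p.1 =
      fderiv ℝ (fun z : ℝ × ℝ × P n => H z.1 z.2.1 z.2.2) (p.1, p.2, u p) (1, 0, 0) := by
    intro p
    rw [fderiv_hamiltonian hH]
    simp [omegaN]
  simp_rw [h]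
  have := hH.continuous_fderiv one_ne_zero
  fun_prop

/-- Energy identity, as an inequality. -/
theorem exists_hasDerivAt_floerAction
    (hH : ContDiff ℝ 1 (fun z : ℝ × ℝ × P n => H z.1 z.2.1 z.2.2)) (hu : ContDiff ℝ 2 u)
    (hper : ∀ s t, u (s, t + 1) = u (s, t))
    (hen : ∀ s t, ‖pd₁ u (s, t)‖ ^ 2 / 2 ≤
      -omegaN (pd₁ u (s, t)) (pd₂ u (s, t) - XH (H s t) (u (s, t)))) :
    ∃ A' : ℝ → ℝ, Continuous A' ∧ (∀ s, HasDerivAt (floerAction H u) (A' s) s) ∧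
      ∀ s, (∫ t in (0 : ℝ)..1, ‖pd₁ u (s, t)‖ ^ 2) / 2 +
        (∫ t in (0 : ℝ)..1, deriv (fun s' => H s' t (u (s, t))) s) ≤ -A' s := by
  set Hf := fun z : ℝ × ℝ × P n => H z.1 z.2.1 z.2.2 with hHf
  have c0 := hu.continuous
  have c1 : Continuous (pd₁ u) := (ContDiff.pd₁ (m := 1) hu).continuous
  have c2 : Continuous (pd₂ u) := (ContDiff.pd₂ (m := 1) hu).continuous
  have cH : Continuous Hf := hH.continuous
  have cdH : Continuous (fderiv ℝ Hf) := hH.continuous_fderiv one_ne_zero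
  have cds : Continuous fun p : ℝ × ℝ => deriv (fun s' => H s' p.2 (u p)) p.1 :=
    continuous_deriv_hamiltonian hH c0
  have hi : ∀ g : ℝ → ℝ, Continuous g → IntervalIntegrable g MeasureTheory.volume 0 1 :=
    fun g hg => hg.intervalIntegrable _ _
  have d0 := hu.differentiable (by norm_num)
  have h1 := hasDerivAt_action hu (a := 0) (b := 1) (fun r => by simpa using hper r 0)
  have cF : Continuous fun p : ℝ × ℝ => fderiv ℝ Hf (p.1, p.2, u p) (1, 0, pd₁ u p) := by fun_prop
  have h2 := hasDerivAt_integral_param (F := fun s t => H s t (u (s, t)))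
    (F' := fun s t => fderiv ℝ Hf (s, t, u (s, t)) (1, 0, pd₁ u (s, t))) 0 1
    (cH.comp (by fun_prop : Continuous fun p : ℝ × ℝ => (p.1, p.2, u p)))
    cF (fun s t => HasFDerivAt.comp_hasDerivAt (f := fun s => (s, t, u (s, t))) s
        (hH.differentiable one_ne_zero _).hasFDerivAt
        ((hasDerivAt_id s).prodMk ((hasDerivAt_const s t).prodMk (hasDerivAt_pd₁ (d0 _)))))
  refine ⟨_, ?_, fun s => ((h1 s).div_const 2).sub (h2 s), fun s => ?_⟩
  · have k1 := continuous_integral_param (F := fun s t => omegaN (pd₁ u (s, t)) (pd₂ u (s, t)))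
      0 1 (by simp only [Function.uncurry_def]; fun_prop)
    have k2 := continuous_integral_param
      (F := fun s t => fderiv ℝ Hf (s, t, u (s, t)) (1, 0, pd₁ u (s, t))) 0 1 cF
    fun_prop
  · have j1 : Continuous fun t => ‖pd₁ u (s, t)‖ ^ 2 / 2 := by fun_prop
    have j2 : Continuous fun t => deriv (fun s' => H s' t (u (s, t))) s :=
      cds.comp (by fun_prop : Continuous fun t => (s, t))
    have j3 : Continuous fun t => fderiv ℝ Hf (s, t, u (s, t)) (1, 0, pd₁ u (s, t)) :=
      cF.comp (by fun_prop : Continuous fun t => (s, t))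
    have j4 : Continuous fun t => omegaN (pd₁ u (s, t)) (pd₂ u (s, t)) := by fun_prop
    rw [← intervalIntegral.integral_div, ← intervalIntegral.integral_add (hi _ j1) (hi _ j2),
      mul_div_cancel_left₀ _ two_ne_zero, ← intervalIntegral.integral_sub (hi _ j4) (hi _ j3),
      ← intervalIntegral.integral_neg]
    refine intervalIntegral.integral_mono_on zero_le_one (hi _ (j1.add j2))
      (hi _ (j4.sub j3).neg) fun t _ => ?_
    have := hen s t
    rw [omegaN_sub_right] at this
    rw [fderiv_hamiltonian hH]
    linarith

theorem abs_floerAction_le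
    (hH : ContDiff ℝ 1 (fun z : ℝ × ℝ × P n => H z.1 z.2.1 z.2.2)) (hu : ContDiff ℝ 2 u)
    {s B M N : ℝ} (hB : 0 ≤ B) (hM : 0 ≤ M) (hus : ∀ t, ‖u (s, t)‖ ≤ B)
    (hHle : ∀ t z, |H s t z| ≤ N * (1 + ‖z‖ ^ 2))
    (hut : ∀ t, ‖pd₂ u (s, t)‖ ≤ M * (1 + ‖u (s, t)‖) + 2 * ‖pd₁ u (s, t)‖) :
    |floerAction H u s| ≤ B * M * (1 + B) + N * (1 + B ^ 2) +
      2 * B * ∫ t in (0 : ℝ)..1, ‖pd₁ u (s, t)‖ := by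
  have c0 := hu.continuous
  have c1 : Continuous (pd₁ u) := (ContDiff.pd₁ (m := 1) hu).continuous
  have c2 : Continuous (pd₂ u) := (ContDiff.pd₂ (m := 1) hu).continuous
  have hN : 0 ≤ N := by
    have := (abs_nonneg _).trans (hHle 0 0)
    simpa using this
  have hi : ∀ g : ℝ → ℝ, Continuous g → IntervalIntegrable g MeasureTheory.volume 0 1 :=
    fun g hg => hg.intervalIntegrable _ _
  have cH : Continuous fun t => H s t (u (s, t)) :=
    hH.continuous.comp (by fun_prop : Continuous fun t : ℝ => (s, t, u (s, t)))
  have h1 : |∫ t in (0 : ℝ)..1, omegaN (u (s, t)) (pd₂ u (s, t))| ≤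
      2 * (B * M * (1 + B)) + 4 * B * ∫ t in (0 : ℝ)..1, ‖pd₁ u (s, t)‖ := by
    rw [← Real.norm_eq_abs]
    refine (intervalIntegral.norm_integral_le_integral_norm zero_le_one).trans ?_
    have : ∫ t in (0 : ℝ)..1, ‖omegaN (u (s, t)) (pd₂ u (s, t))‖ ≤
        ∫ t in (0 : ℝ)..1, (2 * (B * M * (1 + B)) + 4 * B * ‖pd₁ u (s, t)‖) := by
      refine intervalIntegral.integral_mono_on zero_le_one (hi _ (by fun_prop))
        (hi _ (by fun_prop)) fun t _ => ?_
      rw [Real.norm_eq_abs]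
      refine (abs_omegaN_le _ _).trans ?_
      have k1 : ‖pd₂ u (s, t)‖ ≤ M * (1 + B) + 2 * ‖pd₁ u (s, t)‖ :=
        (hut t).trans (by gcongr; exact hus t)
      have k2 : 2 * ‖u (s, t)‖ * ‖pd₂ u (s, t)‖ ≤
          2 * B * (M * (1 + B) + 2 * ‖pd₁ u (s, t)‖) := by
        gcongr
        exact hus t
      linarith
    rw [intervalIntegral.integral_add (hi _ (by fun_prop)) (hi _ (by fun_prop)),
      intervalIntegral.integral_const, smul_eq_mul, intervalIntegral.integral_const_mul] at this
    linarith
  have h2 : |∫ t in (0 : ℝ)..1, H s t (u (s, t))| ≤ N * (1 + B ^ 2) := by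
    rw [← Real.norm_eq_abs]
    have := intervalIntegral.norm_integral_le_of_norm_le_const (a := 0) (b := 1)
      (f := fun t => H s t (u (s, t))) (C := N * (1 + B ^ 2)) fun t _ => by
        rw [Real.norm_eq_abs]
        refine (hHle _ _).trans ?_
        gcongr
        exact hus t
    simpa using this
  unfold floerAction
  refine (abs_sub _ _).trans ?_
  rw [abs_div, abs_two]
  linarith

/-- Uniform bounds for the action along a Floer trajectory with prescribed bounds at its ends. -/
theorem floerAction_bounds
    (hH : ContDiff ℝ 1 (fun z : ℝ × ℝ × P n => H z.1 z.2.1 z.2.2)) (hu : ContDiff ℝ 2 u)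
    {B M N : ℝ} (hB : 0 < B) (hM : 0 ≤ M) {s₁ s₂ : ℝ}
    (hbot : ∀ s ≤ s₁, ∀ t, ‖u (s, t)‖ ≤ B) (htop : ∀ s ≥ s₂, ∀ t, ‖u (s, t)‖ ≤ B)
    (hHle : ∀ s t z, |H s t z| ≤ N * (1 + ‖z‖ ^ 2))
    (hut : ∀ s t, ‖pd₂ u (s, t)‖ ≤ M * (1 + ‖u (s, t)‖) + 2 * ‖pd₁ u (s, t)‖)
    {A' : ℝ → ℝ} (hA : ∀ s, HasDerivAt (floerAction H u) (A' s) s)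
    (hA' : ∀ s, (∫ t in (0 : ℝ)..1, ‖pd₁ u (s, t)‖ ^ 2) / 2 ≤ -A' s) (s : ℝ) :
    |floerAction H u s| ≤ B * M * (1 + B) + N * (1 + B ^ 2) := by
  set C₀ := B * M * (1 + B) + N * (1 + B ^ 2) with hC₀
  have c1 : Continuous (pd₁ u) := (ContDiff.pd₁ (m := 1) hu).continuous
  have key : ∀ s, (∀ t, ‖u (s, t)‖ ≤ B) → ∀ x, x ≤ |floerAction H u s| - C₀ → 0 < x →
      x ^ 2 ≤ 8 * B ^ 2 * (-A' s) := by
    intro s hs x hx hx0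
    have h1 := abs_floerAction_le hH hu hB.le hM hs (hHle s) (hut s)
    have h2 : x ≤ 2 * B * ∫ t in (0 : ℝ)..1, ‖pd₁ u (s, t)‖ := by linarith
    have h3 := pow_le_pow_left₀ hx0.le h2 2
    have h4 := sq_intervalIntegral_le (f := fun t => ‖pd₁ u (s, t)‖) (by fun_prop) (zero_lt_one' ℝ)
    have h5 : (∫ t in (0 : ℝ)..1, ‖pd₁ u (s, t)‖) ^ 2 ≤ 2 * (-A' s) := by
      linarith [hA' s]
    have h6 := mul_le_mul_of_nonneg_left h5 (by positivity : 0 ≤ (2 * B) ^ 2)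
    rw [← mul_pow] at h6
    linarith
  have hneg : ∀ s, A' s ≤ 0 := fun s => by
    have : 0 ≤ ∫ t in (0 : ℝ)..1, ‖pd₁ u (s, t)‖ ^ 2 :=
      intervalIntegral.integral_nonneg zero_le_one fun t _ => by positivity
    linarith [hA' s]
  have hup := nonpos_of_sq_le_neg_deriv (y := fun s => floerAction H u s - C₀) (s₁ := s₁)
    (by positivity : 0 < 8 * B ^ 2) (fun s => (hA s).sub_const C₀) hneg
    (fun s hs hp => key s (hbot s hs) _ (by linarith [le_abs_self (floerAction H u s)]) hp) s
  have hdown := nonpos_of_sq_le_neg_deriv (y := fun s => -floerAction H u (-s) - C₀)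
    (y' := fun s => A' (-s)) (s₁ := -s₂)
    (by positivity : 0 < 8 * B ^ 2)
    (fun s => by
      have := (((hA (-s)).scomp s (hasDerivAt_neg s)).neg).sub_const C₀
      simpa using this) (fun s => hneg _)
    (fun s hs hp => key (-s) (htop (-s) (by linarith)) _
      (by linarith [neg_abs_le (floerAction H u (-s))]) hp) (-s)
  simp only [neg_neg] at hdown
  rw [abs_le]
  constructor <;> linarith

end Energy

section Coefficient

theorem eq_of_abs_Qa_sub_le {n : ℕ} [Nontrivial (E n)] {a b C : ℝ}
    (h : ∀ z : P n, |Qa a z - Qa b z| ≤ C) : a = b := by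
  by_contra hne
  have hab : 0 < |a - b| := abs_pos.2 (sub_ne_zero.2 hne)
  obtain ⟨q, hq⟩ := NormedSpace.exists_lt_norm ℝ (E n) (1 + C / |a - b|)
  have hC : 0 ≤ C := (abs_nonneg _).trans (h 0)
  have hd : 0 ≤ C / |a - b| := by positivity
  have h1 := h (q, 0)
  have e : Qa a (q, (0 : E n)) - Qa b (q, 0) = (a - b) * ‖q‖ ^ 2 := by simp [Qa]; ring
  rw [e, abs_mul, abs_of_nonneg (sq_nonneg ‖q‖)] at h1
  have h2 : C / |a - b| < ‖q‖ ^ 2 := by nlinarith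
  rw [div_lt_iff₀ hab] at h2
  linarith

theorem exists_pos_le_sin_sq_add_deriv {a : ℝ → ℝ} (ha : ContDiff ℝ 1 a) {s₀ : ℝ} (hs₀ : 0 < s₀)
    (h0 : ∀ s, 0 ≤ deriv a s) (hpos : ∀ s, (∃ k : ℤ, a s = (k : ℝ) * Real.pi) → 0 < deriv a s)
    (htop : ∀ s, s₀ ≤ s → a s = a s₀) (hbot : ∀ s, s ≤ -s₀ → a s = a (-s₀)) :
    ∃ κ > 0, ∀ s, κ ≤ Real.sin (a s) ^ 2 + deriv a s := by
  have cont : Continuous fun s => Real.sin (a s) ^ 2 + deriv a s := by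
    have := ha.continuous
    have := ha.continuous_deriv le_rfl
    fun_prop
  have pos : ∀ s, 0 < Real.sin (a s) ^ 2 + deriv a s := by
    intro s
    by_cases hs : Real.sin (a s) = 0
    · obtain ⟨k, hk⟩ := Real.sin_eq_zero_iff.1 hs
      have := hpos s ⟨k, hk.symm⟩
      positivity
    · have := h0 s
      positivity
  have dtop : ∀ s, s₀ < s → deriv a s = 0 := fun s hs => by
    have : a =ᶠ[nhds s] fun _ => a s₀ :=
      (eventually_gt_nhds hs).mono fun r hr => htop r hr.le
    rw [this.deriv_eq, deriv_const]
  have dbot : ∀ s, s < -s₀ → deriv a s = 0 := fun s hs => by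
    have : a =ᶠ[nhds s] fun _ => a (-s₀) :=
      (eventually_lt_nhds hs).mono fun r hr => hbot r hr.le
    rw [this.deriv_eq, deriv_const]
  obtain ⟨r, -, hr⟩ := (isCompact_Icc (a := -(s₀ + 1)) (b := s₀ + 1)).exists_isMinOn
    (Set.nonempty_Icc.2 (by linarith)) cont.continuousOn
  rw [isMinOn_iff] at hr
  refine ⟨_, pos r, fun s => ?_⟩
  rcases lt_or_ge s (-(s₀ + 1)) with h1 | h1
  · have := hr (-(s₀ + 1)) ⟨le_rfl, by linarith⟩
    rw [dbot _ (by linarith : -(s₀ + 1) < -s₀), hbot _ (by linarith : -(s₀ + 1) ≤ -s₀)] at this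
    rwa [dbot s (by linarith), hbot s (by linarith)]
  rcases lt_or_ge (s₀ + 1) s with h2 | h2
  · have := hr (s₀ + 1) ⟨by linarith, le_rfl⟩
    rw [dtop _ (by linarith : s₀ < s₀ + 1), htop _ (by linarith : s₀ ≤ s₀ + 1)] at this
    rwa [dtop s (by linarith), htop s (by linarith)]
  · exact hr s ⟨h1, h2⟩

end Coefficient

section Absorb

/-- A bounded function is bounded by `2 * K` as soon as every bound `B` improves to
`B / 2 + K`. -/
theorem norm_le_of_bound_improves {X V : Type*} [Nonempty X] [NormedAddCommGroup V] {f : X → V}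
    {K B₀ : ℝ} (hf : ∀ x, ‖f x‖ ≤ B₀)
    (h : ∀ B, 0 ≤ B → (∀ x, ‖f x‖ ≤ B) → ∀ x, ‖f x‖ ≤ B / 2 + K) (x : X) : ‖f x‖ ≤ 2 * K := by
  have hb : BddAbove (Set.range fun x => ‖f x‖) := ⟨B₀, by rintro _ ⟨y, rfl⟩; exact hf y⟩
  have hle : ∀ y, ‖f y‖ ≤ ⨆ y, ‖f y‖ := fun y => le_ciSup hb y
  have := ciSup_le (h _ ((norm_nonneg _).trans (hle x)) hle)
  linarith [hle x]

/-- A continuous function on the cylinder that is bounded near both ends is bounded. -/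
theorem exists_norm_le_of_ends {V : Type*} [NormedAddCommGroup V] {f : ℝ × ℝ → V}
    (hf : Continuous f) (hper : ∀ s t, f (s, t + 1) = f (s, t)) {B s₁ s₂ : ℝ}
    (hbot : ∀ s ≤ s₁, ∀ t, ‖f (s, t)‖ ≤ B) (htop : ∀ s ≥ s₂, ∀ t, ‖f (s, t)‖ ≤ B) :
    ∃ B₀, ∀ z, ‖f z‖ ≤ B₀ := by
  obtain ⟨B₁, hB₁⟩ := ((isCompact_Icc (a := s₁) (b := s₂)).prod
    (isCompact_Icc (a := (0 : ℝ)) (b := 1))).exists_bound_of_continuousOn hf.continuousOn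
  refine ⟨max B B₁, fun ⟨s, t⟩ => ?_⟩
  rcases le_total s s₁ with h1 | h1
  · exact (hbot s h1 t).trans (le_max_left _ _)
  rcases le_total s₂ s with h2 | h2
  · exact (htop s h2 t).trans (le_max_left _ _)
  have hp : Function.Periodic (fun t => f (s, t)) 1 := hper s
  obtain ⟨t', ht', e⟩ := hp.exists_mem_Ico₀ one_pos t
  rw [e]
  exact (hB₁ (s, t') ⟨⟨h1, h2⟩, ht'.1, ht'.2.le⟩).trans (le_max_right _ _)

theorem exists_norm_le_of_periodic {V : Type*} [NormedAddCommGroup V] {x : ℝ → V}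
    (hx : Continuous x) (hper : Function.Periodic x 1) : ∃ b, ∀ t, ‖x t‖ ≤ b := by
  obtain ⟨b, hb⟩ := (hper.compact_of_continuous one_ne_zero hx).isBounded.exists_norm_le
  exact ⟨b, fun t => hb _ (Set.mem_range_self t)⟩

end Absorb

section Integral

variable {n : ℕ}

/-- The `L²` bound along a loop, from nonresonance and growth in `s`. -/
theorem sin_sq_add_mul_integral_le {w w' v X : ℝ → P n} {g : ℝ → ℝ} {a a' C : ℝ}
    (hw : ∀ t, HasDerivAt w (w' t) t) (hw' : Continuous w') (hper : ∀ t, w (t + 1) = w t)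
    (hv : Continuous v) (hg : Continuous g)
    (hX : ∀ t, ‖X t - (2 * a) • Jstd n (w t)‖ ≤ C) (hJ : ∀ t, ‖w' t - X t‖ ≤ 2 * ‖v t‖)
    (hgw : ∀ t, a' * ‖w t‖ ^ 2 - C ≤ g t) :
    (Real.sin a ^ 2 + a') * (∫ t in (0 : ℝ)..1, ‖w t‖ ^ 2) ≤
      8 * C ^ 2 + C + 32 * (∫ t in (0 : ℝ)..1, ‖v t‖ ^ 2) + ∫ t in (0 : ℝ)..1, g t := by
  have cw : Continuous w := continuous_iff_continuousAt.2 fun t => (hw t).continuousAt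
  have hi : ∀ g : ℝ → ℝ, Continuous g → IntervalIntegrable g MeasureTheory.volume 0 1 :=
    fun g hg => hg.intervalIntegrable _ _
  have h1 := sin_sq_mul_integral_le a hw hw' hper
  have h2 : ∫ τ in (0 : ℝ)..1, ‖w' τ - (2 * a) • Jstd n (w τ)‖ ^ 2 ≤
      ∫ τ in (0 : ℝ)..1, (2 * C ^ 2 + 8 * ‖v τ‖ ^ 2) := by
    refine intervalIntegral.integral_mono_on zero_le_one (hi _ (by fun_prop))
      (hi _ (by fun_prop)) fun t _ => ?_
    have k1 : ‖w' t - (2 * a) • Jstd n (w t)‖ ≤ 2 * ‖v t‖ + C := by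
      have := norm_add_le (w' t - X t) (X t - (2 * a) • Jstd n (w t))
      rw [sub_add_sub_cancel] at this
      linarith [hX t, hJ t]
    have k2 := pow_le_pow_left₀ (norm_nonneg _) k1 2
    nlinarith [sq_nonneg (2 * ‖v t‖ - C)]
  rw [intervalIntegral.integral_add (hi _ (by fun_prop)) (hi _ (by fun_prop)),
    intervalIntegral.integral_const, smul_eq_mul, intervalIntegral.integral_const_mul] at h2
  have h3 : ∫ t in (0 : ℝ)..1, (a' * ‖w t‖ ^ 2 - C) ≤ ∫ t in (0 : ℝ)..1, g t :=
    intervalIntegral.integral_mono_on zero_le_one (hi _ (by fun_prop)) (hi _ hg) fun t _ => hgw t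
  rw [intervalIntegral.integral_sub (hi _ (by fun_prop)) (hi _ (by fun_prop)),
    intervalIntegral.integral_const, smul_eq_mul, intervalIntegral.integral_const_mul] at h3
  linarith

/-- A pointwise bound of the slice integrals by `-A'` bounds integrals over small squares by the
variation of `A`. -/
theorem integral_square_le {G : ℝ × ℝ → ℝ} {A A' : ℝ → ℝ} (hG : Continuous G)
    (hG0 : ∀ z, 0 ≤ G z) (hper : ∀ s t, G (s, t + 1) = G (s, t)) (hA' : Continuous A')
    (hA : ∀ s, HasDerivAt A (A' s) s) {A₀ K R : ℝ} (hK : 0 ≤ K) (hR : 0 < R) (hR' : R ≤ 1 / 2)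
    (hA₀ : ∀ s, |A s| ≤ A₀) (h : ∀ s, ∫ t in (0 : ℝ)..1, G (s, t) ≤ K * (1 - A' s)) (s₀ t₀ : ℝ) :
    ∫ s in (s₀ - R)..(s₀ + R), ∫ t in (t₀ - R)..(t₀ + R), G (s, t) ≤ K * (1 + 2 * A₀) := by
  have hslice : ∀ s, ∫ t in (t₀ - R)..(t₀ + R), G (s, t) ≤ K * (1 - A' s) := by
    intro s
    have c : Continuous fun t => G (s, t) := by fun_prop
    have hp : Function.Periodic (fun t => G (s, t)) 1 := hper s
    have h1 : ∫ t in (t₀ - R)..(t₀ + R), G (s, t) ≤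
        ∫ t in (t₀ - 1 / 2)..(t₀ - 1 / 2 + 1), G (s, t) :=
      intervalIntegral.integral_mono_interval (by linarith) (by linarith) (by linarith)
        (Eventually.of_forall fun t => hG0 _) (c.intervalIntegrable _ _)
    have h2 := hp.intervalIntegral_add_eq (t₀ - 1 / 2) 0
    rw [zero_add] at h2
    exact h1.trans (h2.le.trans (h s))
  have c1 : Continuous fun s => ∫ t in (t₀ - R)..(t₀ + R), G (s, t) :=
    continuous_integral_param _ _ (F := fun s t => G (s, t)) hG
  have c2 : Continuous fun s => K * (1 - A' s) := by fun_prop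
  have h3 := intervalIntegral.integral_mono_on (μ := MeasureTheory.volume)
    (by linarith : s₀ - R ≤ s₀ + R) (c1.intervalIntegrable _ _) (c2.intervalIntegrable _ _)
    fun s _ => hslice s
  have h4 : ∫ s in (s₀ - R)..(s₀ + R), K * (1 - A' s) =
      K * (s₀ + R - A (s₀ + R)) - K * (s₀ - R - A (s₀ - R)) :=
    intervalIntegral.integral_eq_sub_of_hasDerivAt
      (fun s _ => ((hasDerivAt_id' s).sub (hA s)).const_mul K) (c2.intervalIntegrable _ _)
  rw [h4, ← mul_sub] at h3
  refine h3.trans (mul_le_mul_of_nonneg_left ?_ hK)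
  have h5 := abs_le.1 (hA₀ (s₀ + R))
  have h6 := abs_le.1 (hA₀ (s₀ - R))
  linarith

end Integral

section Pointwise

variable {n : ℕ} {J : P n →L[ℝ] P n} {v w X : P n}

theorem J_apply_of_eqn (hJ2 : ∀ ξ, J (J ξ) = -ξ) (h : v = J (w - X)) : J v = X - w := by
  rw [h, hJ2, neg_sub]

theorem norm_sub_le_of_eqn (hJ : ‖J - Jstd n‖ ≤ 1 / 4) (hJ2 : ∀ ξ, J (J ξ) = -ξ)
    (h : v = J (w - X)) : ‖w - X‖ ≤ 2 * ‖v‖ := by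
  rw [norm_sub_rev, ← J_apply_of_eqn hJ2 h]
  exact norm_apply_le_of_near_Jstd hJ v

theorem half_sq_norm_le_of_eqn (hJ : ‖J - Jstd n‖ ≤ 1 / 4) (hJ2 : ∀ ξ, J (J ξ) = -ξ)
    (h : v = J (w - X)) : ‖v‖ ^ 2 / 2 ≤ -omegaN v (w - X) := by
  have := half_sq_norm_le_omegaN hJ v
  rw [J_apply_of_eqn hJ2 h] at this
  rw [omegaN_sub_right] at this ⊢
  linarith

theorem sq_norm_add_sq_norm_le_of_eqn (hJ : ‖J - Jstd n‖ ≤ 1 / 4) (hJ2 : ∀ ξ, J (J ξ) = -ξ)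
    (h : v = J (w - X)) {c : ℝ} (hX : ‖X‖ ≤ c) :
    (‖v‖ ^ 2 + ‖w‖ ^ 2) / 64 - 5 * c ^ 2 ≤ -omegaN v w := by
  have h1 := half_sq_norm_le_of_eqn hJ hJ2 h
  rw [omegaN_sub_right] at h1
  have h2 := (abs_le.1 (abs_omegaN_le v X)).2
  have h3 : 2 * ‖v‖ * ‖X‖ ≤ 2 * ‖v‖ * c := by gcongr
  have h4 : ‖w‖ ≤ 2 * ‖v‖ + c := by
    have := norm_add_le (w - X) X
    rw [sub_add_cancel] at this
    linarith [norm_sub_le_of_eqn hJ hJ2 h]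
  have h5 := pow_le_pow_left₀ (norm_nonneg _) h4 2
  have h6 := (abs_le.1 (abs_omegaN_le v X)).1
  nlinarith [sq_nonneg (2 * ‖v‖ - c), sq_nonneg (‖v‖ / 2 - 2 * c), sq_nonneg ‖v‖]

end Pointwise

section Bound

variable {n : ℕ}

/-- Uniform bound for Floer trajectories in terms of constants that do not depend on the
trajectory. -/
theorem exists_norm_le_floer {H : ℝ → ℝ → P n → ℝ} {a : ℝ → ℝ} {C M N B κ : ℝ}
    (hH : ContDiff ℝ 1 (fun z : ℝ × ℝ × P n => H z.1 z.2.1 z.2.2))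
    (hM : 0 ≤ M) (hB : 0 < B) (hκ : 0 < κ)
    (hX : ∀ s t z, ‖XH (H s t) z - (2 * a s) • Jstd n z‖ ≤ C)
    (hXM : ∀ s t z, ‖XH (H s t) z‖ ≤ M * (1 + ‖z‖))
    (hHN : ∀ s t z, |H s t z| ≤ N * (1 + ‖z‖ ^ 2))
    (hs0 : ∀ s t z, 0 ≤ deriv (fun s' => H s' t z) s)
    (hs : ∀ s t z, deriv a s * ‖z‖ ^ 2 - C ≤ deriv (fun s' => H s' t z) s)
    (ha : ∀ s, κ ≤ Real.sin (a s) ^ 2 + deriv a s) :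
    ∃ R > (0 : ℝ), ∀ (u : ℝ × ℝ → P n) (J : ℝ × ℝ → P n →L[ℝ] P n), ContDiff ℝ 2 u →
      (∀ s t, u (s, t + 1) = u (s, t)) → (∀ z, ‖J z - Jstd n‖ ≤ 1 / 4) →
      (∀ z ξ, J z (J z ξ) = -ξ) →
      (∀ z, pd₁ u z = J z (pd₂ u z - XH (H z.1 z.2) (u z))) →
      (∃ s₁, ∀ s ≤ s₁, ∀ t, ‖u (s, t)‖ ≤ B) → (∃ s₂, ∀ s ≥ s₂, ∀ t, ‖u (s, t)‖ ≤ B) →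
      ∀ z, ‖u z‖ ≤ R := by
  have hC : 0 ≤ C := (norm_nonneg _).trans (hX 0 0 0)
  have hN : 0 ≤ N := by
    have := (abs_nonneg _).trans (hHN 0 0 0)
    simpa using this
  obtain ⟨r, K, hr, hr', hK, hloc⟩ :=
    exists_norm_le_local n (D := 5 * M ^ 2) (by positivity)
  set A₀ := B * M * (1 + B) + N * (1 + B ^ 2) with hA₀
  have hA₀' : 0 ≤ A₀ := by positivity
  set L := (8 * C ^ 2 + C + 64) / κ with hL
  have hL0 : 0 ≤ L := by positivity
  set K' := 4 * M ^ 2 + (1 + 4 * M ^ 2) * L + 18 with hK'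
  refine ⟨2 * (K * (1 + K' * (1 + 2 * A₀))) + 1, by positivity, ?_⟩
  rintro u J hu hper hJ hJ2 heq ⟨s₁, hbot⟩ ⟨s₂, htop⟩
  have c0 := hu.continuous
  have c1 : Continuous (pd₁ u) := (ContDiff.pd₁ (m := 1) hu).continuous
  have c2 : Continuous (pd₂ u) := (ContDiff.pd₂ (m := 1) hu).continuous
  have d0 := hu.differentiable (by norm_num)
  have hi : ∀ g : ℝ → ℝ, Continuous g → IntervalIntegrable g MeasureTheory.volume 0 1 :=
    fun g hg => hg.intervalIntegrable _ _
  have hut : ∀ s t, ‖pd₂ u (s, t)‖ ≤ M * (1 + ‖u (s, t)‖) + 2 * ‖pd₁ u (s, t)‖ := fun s t => by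
    have h1 := norm_add_le (pd₂ u (s, t) - XH (H s t) (u (s, t))) (XH (H s t) (u (s, t)))
    rw [sub_add_cancel] at h1
    linarith [norm_sub_le_of_eqn (hJ (s, t)) (hJ2 _) (heq (s, t)), hXM s t (u (s, t))]
  obtain ⟨A', cA', hA, hA'⟩ := exists_hasDerivAt_floerAction hH hu hper
    fun s t => half_sq_norm_le_of_eqn (hJ (s, t)) (hJ2 _) (heq (s, t))
  have cg : ∀ s, Continuous fun t => deriv (fun s' => H s' t (u (s, t))) s := fun s =>
    (continuous_deriv_hamiltonian hH c0).comp (by fun_prop : Continuous fun t => (s, t))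
  have hg0 : ∀ s, 0 ≤ ∫ t in (0 : ℝ)..1, deriv (fun s' => H s' t (u (s, t))) s := fun s =>
    intervalIntegral.integral_nonneg zero_le_one fun t _ => hs0 _ _ _
  have hh0 : ∀ s, 0 ≤ ∫ t in (0 : ℝ)..1, ‖pd₁ u (s, t)‖ ^ 2 := fun s =>
    intervalIntegral.integral_nonneg zero_le_one fun t _ => by positivity
  have hAbd := floerAction_bounds hH hu hB hM hbot htop hHN hut hA
    fun s => by linarith [hA' s, hg0 s]
  set G : ℝ × ℝ → ℝ := fun z => ‖u z‖ ^ 2 + (‖pd₁ u z‖ ^ 2 + ‖pd₂ u z‖ ^ 2) with hG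
  have hGs : ∀ s, ∫ t in (0 : ℝ)..1, G (s, t) ≤ K' * (1 - A' s) := by
    intro s
    have h1 := sin_sq_add_mul_integral_le (a := a s) (a' := deriv a s) (C := C)
      (fun t => hasDerivAt_pd₂ (d0 (s, t))) (by fun_prop) (hper s)
      (by fun_prop : Continuous fun t => pd₁ u (s, t)) (cg s) (fun t => hX s t _)
      (fun t => norm_sub_le_of_eqn (hJ (s, t)) (hJ2 _) (heq (s, t))) (fun t => hs s t _)
    set W := ∫ t in (0 : ℝ)..1, ‖u (s, t)‖ ^ 2
    set h := ∫ t in (0 : ℝ)..1, ‖pd₁ u (s, t)‖ ^ 2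
    set g := ∫ t in (0 : ℝ)..1, deriv (fun s' => H s' t (u (s, t))) s
    have hW : 0 ≤ W := intervalIntegral.integral_nonneg zero_le_one fun t _ => by positivity
    have h2 : h / 2 + g ≤ -A' s := hA' s
    have h3 : 0 ≤ h := hh0 s
    have h4 : 0 ≤ g := hg0 s
    have h5 : W ≤ L * (1 - A' s) := by
      rw [hL, div_mul_eq_mul_div, le_div_iff₀ hκ]
      have := mul_le_mul_of_nonneg_right (ha s) hW
      have : 0 ≤ (8 * C ^ 2 + C) * (-A' s) := mul_nonneg (by positivity) (by linarith)
      linarith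
    have h6 : ∫ t in (0 : ℝ)..1, G (s, t) ≤ ∫ t in (0 : ℝ)..1,
        (4 * M ^ 2 + ((1 + 4 * M ^ 2) * ‖u (s, t)‖ ^ 2 + 9 * ‖pd₁ u (s, t)‖ ^ 2)) := by
      refine intervalIntegral.integral_mono_on zero_le_one (hi _ (by fun_prop))
        (hi _ (by fun_prop)) fun t _ => ?_
      have k1 := pow_le_pow_left₀ (norm_nonneg _) (hut s t) 2
      have k2 := sq_nonneg (M * (1 + ‖u (s, t)‖) - 2 * ‖pd₁ u (s, t)‖)
      have k3 := mul_nonneg (sq_nonneg M) (sq_nonneg (1 - ‖u (s, t)‖))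
      simp only [hG]
      linarith
    refine h6.trans ?_
    rw [intervalIntegral.integral_add (hi _ (by fun_prop)) (hi _ (by fun_prop)),
      intervalIntegral.integral_add (hi _ (by fun_prop)) (hi _ (by fun_prop)),
      intervalIntegral.integral_const, smul_eq_mul, intervalIntegral.integral_const_mul,
      intervalIntegral.integral_const_mul]
    have h7 := mul_le_mul_of_nonneg_left h5 (by positivity : 0 ≤ 1 + 4 * M ^ 2)
    have h8 : 0 ≤ M ^ 2 * (-A' s) := mul_nonneg (by positivity) (by linarith)
    rw [hK']
    linarith
  have p1 : ∀ s t, pd₁ u (s, t + 1) = pd₁ u (s, t) := fun s t => by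
    have h1 := hasDerivAt_pd₁ (d0 (s, t + 1))
    simp only [hper] at h1
    exact h1.unique (hasDerivAt_pd₁ (d0 (s, t)))
  have p2 : ∀ s t, pd₂ u (s, t + 1) = pd₂ u (s, t) := fun s t => by
    have h1 := (hasDerivAt_pd₂ (d0 (s, t + 1))).comp_add_const t 1
    simp only [hper] at h1
    exact h1.unique (hasDerivAt_pd₂ (d0 (s, t)))
  have hsq := integral_square_le (G := G) (by fun_prop) (fun z => by positivity)
    (fun s t => by simp only [hG, hper, p1, p2]) cA' hA (by positivity : 0 ≤ K') hr hr' hAbd hGs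
  obtain ⟨B₀, hB₀⟩ := exists_norm_le_of_ends c0 hper hbot htop
  intro z
  refine (norm_le_of_bound_improves (K := K * (1 + K' * (1 + 2 * A₀))) hB₀ ?_ z).trans
    (by linarith)
  rintro B' hB' hle ⟨s, t⟩
  refine (hloc u hu B' hB' (fun z => ?_) s t).trans ?_
  · have := sq_norm_add_sq_norm_le_of_eqn (hJ z) (hJ2 _) (heq z)
      ((hXM z.1 z.2 (u z)).trans (by gcongr; exact hle z) : _ ≤ M * (1 + B'))
    linarith
  · gcongr
    exact hsq s t

end Bound

section Hamiltonian

variable {n : ℕ} {Hm Hp : ℝ → P n → ℝ} {H : ℝ → ℝ → P n → ℝ}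

/-- The uniform growth constants of a homotopy. -/
theorem IsHomotopy.exists_constants [Nontrivial (E n)] (h : IsHomotopy Hm Hp H) :
    ∃ (a : ℝ → ℝ) (C M N κ : ℝ), 0 ≤ M ∧ 0 < κ ∧
      (∀ s t z, ‖XH (H s t) z - (2 * a s) • Jstd n z‖ ≤ C) ∧
      (∀ s t z, ‖XH (H s t) z‖ ≤ M * (1 + ‖z‖)) ∧
      (∀ s t z, |H s t z| ≤ N * (1 + ‖z‖ ^ 2)) ∧
      (∀ s t z, deriv a s * ‖z‖ ^ 2 - C ≤ deriv (fun s' => H s' t z) s) ∧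
      ∀ s, κ ≤ Real.sin (a s) ^ 2 + deriv a s := by
  obtain ⟨s₀, hs₀, hHp, hHm⟩ := h.hh1
  obtain ⟨a, ha, ha0, hapos, C, hC⟩ := h.hh3
  have heq : ∀ s s', (∀ z, H s 0 z = H s' 0 z) → a s = a s' := fun s s' hss =>
    eq_of_abs_Qa_sub_le (C := C + C) fun z => by
      have h1 := (hC s 0 z).1
      have h2 := (hC s' 0 z).1
      rw [hss z] at h1
      rw [abs_le] at h1 h2 ⊢
      constructor <;> linarith [h1.1, h1.2, h2.1, h2.2]
  have htop : ∀ s, s₀ ≤ s → a s = a s₀ := fun s hs =>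
    heq _ _ fun z => (hHp s 0 z hs).trans (hHp s₀ 0 z le_rfl).symm
  have hbot : ∀ s, s ≤ -s₀ → a s = a (-s₀) := fun s hs =>
    heq _ _ fun z => (hHm s 0 z hs).trans (hHm (-s₀) 0 z le_rfl).symm
  have hd : Differentiable ℝ a := ha.differentiable (by simp)
  obtain ⟨κ, hκ, hκa⟩ := exists_pos_le_sin_sq_add_deriv (ha.of_le (by exact_mod_cast le_top)) hs₀
    ha0 hapos htop hbot
  have hmono := monotone_of_deriv_nonneg hd ha0
  set α := |a (-s₀)| + |a s₀| with hα
  have hα0 : 0 ≤ α := by positivity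
  have haα : ∀ s, |a s| ≤ α := fun s => by
    have h1 : a s ≤ a s₀ := (hmono (le_max_left s s₀)).trans (htop _ (le_max_right _ _)).le
    have h2 : a (-s₀) ≤ a s := (hbot _ (min_le_right s _)).ge.trans (hmono (min_le_left _ _))
    rw [abs_le]
    constructor <;>
      linarith [neg_abs_le (a (-s₀)), le_abs_self (a s₀), abs_nonneg (a (-s₀)), abs_nonneg (a s₀)]
  have hC0 : 0 ≤ C := (abs_nonneg _).trans (hC 0 0 0).1
  have hdH : ∀ s t z, DifferentiableAt ℝ (H s t) z := fun s t z =>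
    ((h.smooth.differentiable (by simp) (s, t, z)).comp z
      (by fun_prop : DifferentiableAt ℝ (fun w : P n => (s, t, w)) z) :)
  have hX : ∀ s t z, ‖XH (H s t) z - (2 * a s) • Jstd n z‖ ≤ C := fun s t z =>
    norm_XH_sub_le (hdH s t z) (hC s t z).2.1
  refine ⟨a, C, C + 2 * α, C + 2 * α, κ, by positivity, hκ, hX, ?_, ?_, ?_, hκa⟩
  · intro s t z
    have h1 := norm_add_le (XH (H s t) z - (2 * a s) • Jstd n z) ((2 * a s) • Jstd n z)
    rw [sub_add_cancel, norm_smul, norm_Jstd_apply, Real.norm_eq_abs, abs_mul, abs_two] at h1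
    have h2 := mul_le_mul_of_nonneg_right (haα s) (norm_nonneg z)
    have h3 := mul_nonneg hC0 (norm_nonneg z)
    linarith [hX s t z]
  · intro s t z
    have h1 : |Qa (a s) z| ≤ α * (2 * ‖z‖ ^ 2) := by
      rw [Qa, abs_mul, abs_of_nonneg (by positivity : 0 ≤ ‖z.1‖ ^ 2 + ‖z.2‖ ^ 2)]
      exact mul_le_mul (haα s) (add_sq_le_two_mul_sq_norm z) (by positivity) hα0
    have h2 := abs_add_le (H s t z - Qa (a s) z) (Qa (a s) z)
    rw [sub_add_cancel] at h2
    have h3 := mul_nonneg hC0 (sq_nonneg ‖z‖)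
    linarith [(hC s t z).1]
  · intro s t z
    have h1 : DifferentiableAt ℝ (fun s' => H s' t z) s :=
      ((h.smooth.differentiable (by simp) (s, t, z)).comp s
        (by fun_prop : DifferentiableAt ℝ (fun r : ℝ => (r, t, z)) s) :)
    have h2 := h1.hasDerivAt.sub ((hd s).hasDerivAt.mul_const (‖z.1‖ ^ 2 + ‖z.2‖ ^ 2))
    have h3 : deriv (fun s' => H s' t z - Qa (a s') z) s = _ := h2.deriv
    have h4 := (hC s t z).2.2
    rw [h3] at h4
    have h5 := mul_le_mul_of_nonneg_left (sq_norm_le_add_sq z) (ha0 s)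
    linarith [neg_le_of_abs_le h4]

end Hamiltonian

/-- Lemma 2.5: there is `ε > 0` such that for any homotopy `H` of
admissible Hamiltonians and any homotopy `J` of compatible almost complex structures
satisfying (JJ1) and `sup_{s,t} ‖J_{s,t} − J_std‖_{C⁰} < ε`, the continuation moduli
space `ℳ_{H,J}(x₋, x₊)` is `C⁰`-bounded for all `x₋ ∈ 𝒫(H⁻)`, `x₊ ∈ 𝒫(H⁺)`. -/
theorem stmt1 (n : ℕ) :
    ∃ ε > (0 : ℝ),
      ∀ Hm Hp : ℝ → P n → ℝ, Admissible Hm → Admissible Hp →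
      ∀ H : ℝ → ℝ → P n → ℝ, IsHomotopy Hm Hp H →
      ∀ J : ℝ → ℝ → P n → P n →L[ℝ] P n,
        ContDiff ℝ (⊤ : ℕ∞) (fun z : ℝ × ℝ × P n => J z.1 z.2.1 z.2.2) →
        (∀ s t z, J s (t + 1) z = J s t z) →
        (∀ s t z ξ, J s t z (J s t z ξ) = -ξ) →
        (∀ s t z, Compatible (J s t z)) →
        -- (JJ1)
        (∃ s₁ > (0 : ℝ), ∀ s t z, (s₁ ≤ s → J s t z = J s₁ t z) ∧
            (s ≤ -s₁ → J s t z = J (-s₁) t z)) →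
        -- `sup ‖J − J_std‖ < ε`
        (∃ δ, δ < ε ∧ ∀ s t z, ‖J s t z - Jstd n‖ ≤ δ) →
        ∀ xm xp : ℝ → P n, IsPeriodicOrbit Hm xm → IsPeriodicOrbit Hp xp →
        ∃ R > (0 : ℝ), ∀ u : ℝ → ℝ → P n, ContinuationSol H J xm xp u →
          ∀ s t, ‖u s t‖ ≤ R := by
  refine ⟨1 / 4, by norm_num, ?_⟩
  intro Hm Hp _ _ H hH J _ _ hJ2 _ _ hJδ xm xp hxm hxp
  obtain ⟨δ, hδ, hJδ⟩ := hJδ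
  rcases subsingleton_or_nontrivial (E n) with hsub | hnon
  · exact ⟨1, one_pos, fun u _ s t => by simp [Subsingleton.elim (u s t) 0]⟩
  obtain ⟨a, C, M, N, κ, hM, hκ, hX, hXM, hHN, hs, ha⟩ := hH.exists_constants
  obtain ⟨bm, hbm⟩ := exists_norm_le_of_periodic hxm.smooth.continuous hxm.periodic
  obtain ⟨bp, hbp⟩ := exists_norm_le_of_periodic hxp.smooth.continuous hxp.periodic
  have hbm0 : 0 ≤ bm := (norm_nonneg _).trans (hbm 0)
  have hbp0 : 0 ≤ bp := (norm_nonneg _).trans (hbp 0)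
  obtain ⟨R, hR, hbound⟩ := exists_norm_le_floer (B := bm + bp + 1)
    (hH.smooth.of_le (by exact_mod_cast le_top)) hM (by positivity) hκ hX hXM hHN hH.hh2 hs ha
  refine ⟨R, hR, fun u hu s t => ?_⟩
  have hd := hu.smooth.differentiable (by simp)
  have close : ∀ {y z : P n}, dist y z < 1 → ‖z‖ ≤ ‖y‖ + 1 := fun {y z} hyz => by
    have := norm_sub_norm_le z y
    rw [← dist_eq_norm, dist_comm] at this
    linarith
  refine hbound (fun p => u p.1 p.2) (fun p => J p.1 p.2 (u p.1 p.2))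
    (hu.smooth.of_le (WithTop.coe_le_coe.2 (le_top : (2 : ℕ∞) ≤ ⊤))) hu.periodic
    (fun _ => (hJδ _ _ _).trans hδ.le) (fun _ => hJ2 _ _ _) ?_ ?_ ?_ (s, t)
  · rintro ⟨s, t⟩
    have h := hu.eqn s t
    rwa [(hasDerivAt_pd₁ (hd (s, t))).deriv, (hasDerivAt_pd₂ (hd (s, t))).deriv] at h
  · obtain ⟨s₁, h₁⟩ := eventually_atBot.1
      (Metric.tendstoUniformly_iff.1 hu.tendsto_bot 1 one_pos)
    exact ⟨s₁, fun s hs t => by linarith [close (h₁ s hs t), hbm t]⟩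
  · obtain ⟨s₂, h₂⟩ := eventually_atTop.1
      (Metric.tendstoUniformly_iff.1 hu.tendsto_top 1 one_pos)
    exact ⟨s₂, fun s hs t => by linarith [close (h₂ s hs t), hbp t]⟩

end
end

section
/- Let L ∈ C^∞(S^1 × Tℝ^n) satisfy condition (L1). Let (γ_k)_k be a sequence of loops γ_k : S^1 → ℝ^n, each absolutely continuous with square-integrable derivative, such that the sequence (𝒮_L(γ_k))_k is bounded and the sequence of numbers sup{ |d𝒮_L(γ_k)(ξ)| : ξ ∈ C^∞(S^1,ℝ^n), ∫_0^1 |ξ(t)|² + |ξ̇(t)|² dt ≤ 1 } is bounded. Then (γ_k)_k is C^0-bounded: sup_k max_{t∈S^1} |γ_k(t)| < ∞. -/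
/-!
Statement 2 (Lemma 3.3): C⁰-boundedness of sequences of loops with bounded Lagrangian
action and bounded action differential, for a Lagrangian satisfying (L1).
-/

open scoped RealInnerProductSpace
open MeasureTheory

noncomputable section

/-- A `W^{1,2}`-loop: `γ` is 1-periodic, absolutely continuous with square-integrable
derivative `g` (encoded as: `γ` is the indefinite integral of the locally integrable,
1-periodic function `g`, with `g ∈ L²(S¹)`). -/
structure W12Loop (n : ℕ) (γ g : ℝ → E n) : Prop where
  periodic : ∀ t, γ (t + 1) = γ t
  gper : ∀ t, g (t + 1) = g t
  meas : Measurable g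
  locint : ∀ a b : ℝ, IntervalIntegrable g volume a b
  sq : IntervalIntegrable (fun t => ‖g t‖ ^ 2) volume 0 1
  repr : ∀ t, γ t = γ 0 + ∫ u in (0 : ℝ)..t, g u

/-- Condition (L1): `∃ a ∈ (0,∞) \ πℤ` with
`sup_t ‖L(t,·,·) − (|v|²/(4a) − a|q|²)‖_{C²(Tℝⁿ)} < ∞`. -/
def CondL1 {n : ℕ} (L : ℝ → E n → E n → ℝ) : Prop :=
  ∃ a : ℝ, 0 < a ∧ (∀ k : ℤ, a ≠ (k : ℝ) * Real.pi) ∧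
    ∃ C : ℝ, ∀ (t : ℝ) (z : E n × E n), ∀ i : ℕ, i ≤ 2 →
      ‖iteratedFDeriv ℝ i
        (fun w : E n × E n => L t w.1 w.2 - (‖w.2‖ ^ 2 / (4 * a) - a * ‖w.1‖ ^ 2)) z‖ ≤ C

/-- The Lagrangian action `𝒮_L(γ) = ∫₀¹ L(t, γ(t), γ̇(t)) dt`. -/
def SL {n : ℕ} (L : ℝ → E n → E n → ℝ) (γ g : ℝ → E n) : ℝ :=
  ∫ t in (0 : ℝ)..1, L t (γ t) (g t)

/-- The differential of the Lagrangian action,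
`d𝒮_L(γ)(ξ) = ∫₀¹ ∂_q L(t,γ,γ̇)·ξ + ∂_v L(t,γ,γ̇)·ξ̇ dt`. -/
def dSL {n : ℕ} (L : ℝ → E n → E n → ℝ) (γ g ξ : ℝ → E n) : ℝ :=
  ∫ t in (0 : ℝ)..1,
    ⟪gradient (fun q => L t q (g t)) (γ t), ξ t⟫ +
    ⟪gradient (fun v => L t (γ t) v) (g t), deriv ξ t⟫


section Circle

open Set Filter Topology

/-- Integration by parts on the circle between an indefinite integral and a `C¹` function. -/
lemma integral_mul_periodic_by_parts {u p y : ℝ → ℝ} (hp : IntervalIntegrable p volume 0 1)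
    (hu : ∀ t, u t = u 0 + ∫ s in (0 : ℝ)..t, p s) (hu1 : u 1 = u 0)
    (hy : ContDiff ℝ 1 y) (hy1 : y 1 = y 0) :
    ∫ t in (0 : ℝ)..1, p t * y t = -∫ t in (0 : ℝ)..1, u t * deriv y t := by
  set f : ℝ → ℝ := fun t => ∫ s in (0 : ℝ)..t, p s with hf
  have hfac : AbsolutelyContinuousOnInterval f 0 1 :=
    hp.absolutelyContinuousOnInterval_intervalIntegral (by simp)
  have hyac : AbsolutelyContinuousOnInterval y 0 1 :=
    hy.contDiffOn.absolutelyContinuousOnInterval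
  have hdy : Continuous (deriv y) := hy.continuous_deriv_one
  have hf1 : f 1 = 0 := by have := hu 1; simp only [hf]; linarith
  have hf0 : f 0 = 0 := by simp [hf]
  have hparts := hfac.integral_mul_deriv_eq_deriv_mul hyac
  have hae : ∫ t in (0 : ℝ)..1, deriv f t * y t = ∫ t in (0 : ℝ)..1, p t * y t := by
    apply intervalIntegral.integral_congr_ae
    filter_upwards [hp.ae_hasDerivAt_integral] with t ht htm
    rw [(ht (uIoc_subset_uIcc htm) 0 (by simp)).deriv]
  have hconst : ∫ t in (0 : ℝ)..1, deriv y t = 0 := by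
    rw [hyac.integral_deriv_eq_sub, hy1, sub_self]
  have hsplit : ∫ t in (0 : ℝ)..1, u t * deriv y t
      = ∫ t in (0 : ℝ)..1, f t * deriv y t := by
    have : ∀ t, u t * deriv y t = u 0 * deriv y t + f t * deriv y t := by
      intro t; rw [hu t]; simp only [hf]; ring
    simp_rw [this]
    rw [intervalIntegral.integral_add, intervalIntegral.integral_const_mul, hconst]
    · simp
    · exact (hdy.const_mul _).intervalIntegrable _ _
    · exact (hfac.continuousOn.mul hdy.continuousOn).intervalIntegrable
  rw [hsplit, hparts, hae, hf1, hf0]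
  ring

/-- A continuous periodic function whose pairings with all smooth periodic probability densities
are bounded by `K` is itself bounded by `K`. -/
lemma abs_le_of_abs_integral_density_le {u : ℝ → ℝ} (hu : Continuous u)
    (hper : ∀ t, u (t + 1) = u t) {K : ℝ}
    (hK : ∀ h : ℝ → ℝ, ContDiff ℝ (⊤ : ℕ∞) h → (∀ t, h (t + 1) = h t) → (∀ t, 0 ≤ h t) →
      ∫ t in (0 : ℝ)..1, h t = 1 → |∫ t in (0 : ℝ)..1, u t * h t| ≤ K) (s : ℝ) :
    |u s| ≤ K := by
  set c : ℝ → ℝ := fun x => (1 + Real.cos (2 * Real.pi * (x - s))) / 2 with hc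
  have hcsmooth : ContDiff ℝ (⊤ : ℕ∞) c := by
    simp only [hc]
    fun_prop
  have hcper : ∀ t, c (t + 1) = c t := by
    intro t
    simp only [hc]
    rw [show 2 * Real.pi * (t + 1 - s) = 2 * Real.pi * (t - s) + 2 * Real.pi by ring,
      Real.cos_add_two_pi]
  have hc0 : ∀ t, 0 ≤ c t := fun t => by
    have := Real.neg_one_le_cos (2 * Real.pi * (t - s))
    simp only [hc]; linarith
  have hcs : c s = 1 := by simp [hc]
  have hmax : ∀ y ∈ Icc (s - 1 / 2) (s - 1 / 2 + 1), y ≠ s → c y < c s := by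
    intro y hy hys
    have hlt : Real.cos |2 * Real.pi * (y - s)| < Real.cos 0 := by
      apply Real.cos_lt_cos_of_nonneg_of_le_pi le_rfl
      · have : |y - s| ≤ 1 / 2 := abs_le.2 ⟨by linarith [hy.1], by linarith [hy.2]⟩
        rw [abs_mul, abs_of_pos Real.two_pi_pos]
        nlinarith [Real.pi_pos]
      · exact abs_pos.2 (mul_ne_zero Real.two_pi_pos.ne' (sub_ne_zero.2 hys))
    rw [Real.cos_abs, Real.cos_zero] at hlt
    rw [hcs]
    simp only [hc]; linarith
  have hlim := tendsto_setIntegral_pow_smul_of_unique_maximum_of_isCompact_of_continuousOn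
    (μ := volume) (g := u) (isCompact_Icc (a := s - 1 / 2) (b := s - 1 / 2 + 1))
    hcsmooth.continuous.continuousOn hmax (fun x _ => hc0 x) (by rw [hcs]; exact one_pos)
    (by
      rw [interior_Icc, closure_Ioo (by linarith)]
      exact ⟨by linarith, by linarith⟩) hu.continuousOn
  refine le_of_tendsto hlim.abs (Eventually.of_forall fun m => ?_)
  have hshift : ∀ f : ℝ → ℝ, (∀ t, f (t + 1) = f t) →
      ∫ x in Icc (s - 1 / 2) (s - 1 / 2 + 1), f x = ∫ x in (0 : ℝ)..1, f x := by
    intro f hf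
    rw [integral_Icc_eq_integral_Ioc, ← intervalIntegral.integral_of_le (by linarith),
      Function.Periodic.intervalIntegral_add_eq (f := f) hf (s - 1 / 2) 0, zero_add]
  rw [hshift _ (fun t => by rw [hcper]), hshift _ (fun t => by rw [hcper, hper])]
  have hcm : Continuous fun t => c t ^ m := hcsmooth.continuous.pow m
  have hpos : 0 < ∫ t in (0 : ℝ)..1, c t ^ m := by
    rw [← hshift _ (fun t => by rw [hcper]), integral_Icc_eq_integral_Ioc,
      ← intervalIntegral.integral_of_le (by linarith)]
    exact intervalIntegral.integral_pos (by linarith) hcm.continuousOn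
      (fun t _ => pow_nonneg (hc0 t) m)
      ⟨s, ⟨by linarith, by linarith⟩, by simp [hcs]⟩
  set I := ∫ t in (0 : ℝ)..1, c t ^ m
  have := hK (fun t => I⁻¹ * c t ^ m) (by fun_prop) (fun t => by simp only [hcper])
    (fun t => mul_nonneg (inv_nonneg.2 hpos.le) (pow_nonneg (hc0 t) m))
    (by rw [intervalIntegral.integral_const_mul]; exact inv_mul_cancel₀ hpos.ne')
  rw [smul_eq_mul, ← intervalIntegral.integral_const_mul]
  refine (congrArg abs (intervalIntegral.integral_congr fun t _ => ?_)).trans_le this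
  simp only [smul_eq_mul]
  ring

/-- Smoothness of a function with a given smooth derivative. -/
lemma contDiff_infty_of_hasDerivAt {f f' : ℝ → ℝ} (h : ∀ t, HasDerivAt f (f' t) t)
    (h' : ContDiff ℝ (⊤ : ℕ∞) f') : ContDiff ℝ (⊤ : ℕ∞) f :=
  contDiff_infty_iff_deriv.2 ⟨fun t => (h t).differentiableAt, by
    rwa [show deriv f = f' from funext fun t => (h t).deriv]⟩

/-- The periodic solution of `x'' + 4a²x = 4a sin(a) h` obtained by convolving the density `h`
with the Green kernel `u ↦ cos (2a(u - 1/2))` on `[0,1]`. -/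
lemma exists_periodic_oscillator_solution {a : ℝ} (ha : 0 < a) {h : ℝ → ℝ}
    (hh : ContDiff ℝ (⊤ : ℕ∞) h) (hper : ∀ t, h (t + 1) = h t) (h0 : ∀ t, 0 ≤ h t)
    (h1 : ∫ t in (0 : ℝ)..1, h t = 1) :
    ∃ x y : ℝ → ℝ, ContDiff ℝ (⊤ : ℕ∞) x ∧ ContDiff ℝ (⊤ : ℕ∞) y ∧
      (∀ t, x (t + 1) = x t) ∧ (∀ t, y (t + 1) = y t) ∧
      (∀ t, HasDerivAt x (y t) t) ∧
      (∀ t, HasDerivAt y (4 * a * Real.sin a * h t - 4 * a ^ 2 * x t) t) ∧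
      (∀ t, |x t| ≤ 1) ∧ (∀ t, |y t| ≤ 2 * a) := by
  set p : ℝ → ℝ := fun w => Real.cos (2 * a * w) * h w with hp
  set q : ℝ → ℝ := fun w => Real.sin (2 * a * w) * h w with hq
  have hhc := hh.continuous
  have hpc : Continuous p := by fun_prop
  have hqc : Continuous q := by fun_prop
  set P : ℝ → ℝ := fun t => ∫ w in (t - 1)..t, p w with hP
  set Q : ℝ → ℝ := fun t => ∫ w in (t - 1)..t, q w with hQ
  have hwin : ∀ f : ℝ → ℝ, Continuous f → ∀ t,
      HasDerivAt (fun t => ∫ w in (t - 1)..t, f w) (f t - f (t - 1)) t := by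
    intro f hf t
    have hprim : ∀ t, HasDerivAt (fun t => ∫ w in (0 : ℝ)..t, f w) (f t) t := fun t =>
      intervalIntegral.integral_hasDerivAt_right (hf.intervalIntegrable _ _)
        (hf.stronglyMeasurableAtFilter _ _) hf.continuousAt
    have heq : (fun t => ∫ w in (t - 1)..t, f w)
        = fun t => (∫ w in (0 : ℝ)..t, f w) - ∫ w in (0 : ℝ)..(t - 1), f w :=
      funext fun t => (intervalIntegral.integral_interval_sub_left
        (hf.intervalIntegrable _ _) (hf.intervalIntegrable _ _)).symm
    rw [heq]
    exact (hprim t).sub ((hprim (t - 1)).comp_sub_const t 1)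
  have hhm : ∀ t, h (t - 1) = h t := fun t => by rw [← hper (t - 1), sub_add_cancel]
  set x : ℝ → ℝ := fun t =>
    Real.cos (2 * a * t - a) * P t + Real.sin (2 * a * t - a) * Q t with hx
  set y : ℝ → ℝ := fun t =>
    2 * a * (Real.cos (2 * a * t - a) * Q t - Real.sin (2 * a * t - a) * P t) with hy
  have hlin : ∀ t, HasDerivAt (fun t => 2 * a * t - a) (2 * a) t := fun t => by
    simpa using ((hasDerivAt_id t).const_mul (2 * a)).sub_const a
  have hcos : ∀ t, Real.cos (2 * a * t) =
      Real.cos (2 * a * t - a) * Real.cos a - Real.sin (2 * a * t - a) * Real.sin a := fun t => by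
    rw [← Real.cos_add]; ring_nf
  have hsin : ∀ t, Real.sin (2 * a * t) =
      Real.sin (2 * a * t - a) * Real.cos a + Real.cos (2 * a * t - a) * Real.sin a := fun t => by
    rw [← Real.sin_add]; ring_nf
  have hcos' : ∀ t, Real.cos (2 * a * (t - 1)) =
      Real.cos (2 * a * t - a) * Real.cos a + Real.sin (2 * a * t - a) * Real.sin a := fun t => by
    rw [← Real.cos_sub]; ring_nf
  have hsin' : ∀ t, Real.sin (2 * a * (t - 1)) =
      Real.sin (2 * a * t - a) * Real.cos a - Real.cos (2 * a * t - a) * Real.sin a := fun t => by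
    rw [← Real.sin_sub]; ring_nf
  have hxd : ∀ t, HasDerivAt x (y t) t := by
    intro t
    have := ((hlin t).cos.mul (hwin p hpc t)).add ((hlin t).sin.mul (hwin q hqc t))
    refine this.congr_deriv ?_
    simp only [hy, hp, hq, hP, hQ, hhm, hcos t, hsin t, hcos' t, hsin' t]
    ring
  have hyd : ∀ t, HasDerivAt y (4 * a * Real.sin a * h t - 4 * a ^ 2 * x t) t := by
    intro t
    have := (((hlin t).cos.mul (hwin q hqc t)).sub ((hlin t).sin.mul (hwin p hpc t))).const_mul
      (2 * a)
    refine this.congr_deriv ?_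
    have hcs := Real.sin_sq_add_cos_sq (2 * a * t - a)
    simp only [hx, hp, hq, hP, hQ, hhm, hcos t, hsin t, hcos' t, hsin' t]
    linear_combination (4 * a * Real.sin a * h t) * hcs
  have hshift : ∀ f : ℝ → ℝ, Continuous f → ∀ t, (∫ w in (t + 1 - 1)..(t + 1), f w)
      = ∫ w in (t - 1)..t, f (w + 1) := by
    intro f hf t
    rw [intervalIntegral.integral_comp_add_right]; congr 1; ring
  have hkernel : ∀ t, x t = ∫ w in (t - 1)..t, Real.cos (2 * a * (t - w) - a) * h w := by
    intro t
    simp only [hx, hP, hQ]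
    rw [← intervalIntegral.integral_const_mul, ← intervalIntegral.integral_const_mul,
      ← intervalIntegral.integral_add ((hpc.const_mul _).intervalIntegrable _ _)
        ((hqc.const_mul _).intervalIntegrable _ _)]
    congr 1; funext w
    rw [show 2 * a * (t - w) - a = (2 * a * t - a) - 2 * a * w by ring,
      Real.cos_sub (2 * a * t - a) (2 * a * w)]
    simp only [hp, hq]; ring
  have hkernel' : ∀ t, y t = 2 * a * ∫ w in (t - 1)..t, -Real.sin (2 * a * (t - w) - a) * h w := by
    intro t
    simp only [hy, hP, hQ]
    rw [← intervalIntegral.integral_const_mul, ← intervalIntegral.integral_const_mul,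
      ← intervalIntegral.integral_sub ((hqc.const_mul _).intervalIntegrable _ _)
        ((hpc.const_mul _).intervalIntegrable _ _)]
    congr 2; funext w
    rw [show 2 * a * (t - w) - a = (2 * a * t - a) - 2 * a * w by ring,
      Real.sin_sub (2 * a * t - a) (2 * a * w)]
    simp only [hp, hq]; ring
  have hmass : ∀ t, ∫ w in (t - 1)..t, h w = 1 := by
    intro t
    have := Function.Periodic.intervalIntegral_add_eq (f := h) hper (t - 1) 0
    rwa [sub_add_cancel, zero_add, h1] at this
  have hbound : ∀ (k : ℝ → ℝ), (∀ w, |k w| ≤ 1) → ∀ t,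
      |∫ w in (t - 1)..t, k w * h w| ≤ 1 := by
    intro k hk t
    rw [← Real.norm_eq_abs]
    refine (intervalIntegral.norm_integral_le_of_norm_le (by linarith)
      (ae_of_all _ fun w _ => ?_) (hhc.intervalIntegrable _ _)).trans_eq (hmass t)
    rw [Real.norm_eq_abs, abs_mul, abs_of_nonneg (h0 w)]
    exact mul_le_of_le_one_left (h0 w) (hk w)
  have hPs : ContDiff ℝ (⊤ : ℕ∞) P :=
    contDiff_infty_of_hasDerivAt (hwin p hpc) (by simp only [hp]; fun_prop)
  have hQs : ContDiff ℝ (⊤ : ℕ∞) Q :=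
    contDiff_infty_of_hasDerivAt (hwin q hqc) (by simp only [hq]; fun_prop)
  refine ⟨x, y, by simp only [hx]; fun_prop, by simp only [hy]; fun_prop, ?_, ?_, hxd, hyd, ?_, ?_⟩
  · intro t
    rw [hkernel, hkernel, hshift _ (by fun_prop)]
    congr 1; funext w; rw [hper]; ring_nf
  · intro t
    rw [hkernel', hkernel', hshift _ (by fun_prop)]
    congr 2; funext w; rw [hper]; ring_nf
  · intro t
    rw [hkernel]
    exact hbound _ (fun w => Real.abs_cos_le_one _) t
  · intro t
    rw [hkernel', abs_mul, abs_of_pos (by positivity : 0 < 2 * a)]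
    refine mul_le_of_le_one_right (by positivity) (hbound _ (fun w => ?_) t)
    rw [abs_neg]
    exact Real.abs_sin_le_one _

end Circle

section Lagrangian

variable {n : ℕ}

/-- The pairing of the partial gradients of `f(q,v) + |v|²/(4a) - a|q|²` with `(ξ, η)`. -/
lemma inner_gradient_add_inner_gradient {ℓ : E n → E n → ℝ} {a : ℝ}
    {D : E n × E n →L[ℝ] ℝ} {q v : E n}
    (hD : HasFDerivAt (fun w : E n × E n =>
      ℓ w.1 w.2 - (‖w.2‖ ^ 2 / (4 * a) - a * ‖w.1‖ ^ 2)) D (q, v)) (ξ η : E n) :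
    ⟪gradient (fun q => ℓ q v) q, ξ⟫ + ⟪gradient (fun v => ℓ q v) v, η⟫
      = (⟪v, η⟫ / (2 * a) - 2 * a * ⟪q, ξ⟫) + D (ξ, η) := by
  have hq : HasFDerivAt (fun q => ℓ q v)
      (D.comp (ContinuousLinearMap.inl ℝ (E n) (E n)) - a • ((2 : ℕ) • innerSL ℝ q)) q := by
    have h1 := HasFDerivAt.comp (f := fun q => (q, v)) q hD (hasFDerivAt_prodMk_left q v)
    have h2 := (hasStrictFDerivAt_norm_sq q).hasFDerivAt.const_mul a
    refine ((h1.sub h2).add_const (‖v‖ ^ 2 / (4 * a))).congr_of_eventuallyEq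
      (Filter.Eventually.of_forall fun x => ?_)
    simp only [Function.comp_apply, Pi.sub_apply]
    ring
  have hv : HasFDerivAt (fun v => ℓ q v)
      (D.comp (ContinuousLinearMap.inr ℝ (E n) (E n))
        + (4 * a)⁻¹ • ((2 : ℕ) • innerSL ℝ v)) v := by
    have h1 := HasFDerivAt.comp (f := fun v => (q, v)) v hD (hasFDerivAt_prodMk_right q v)
    have h2 := (hasStrictFDerivAt_norm_sq v).hasFDerivAt.const_mul (4 * a)⁻¹
    refine ((h1.add h2).sub_const (a * ‖q‖ ^ 2)).congr_of_eventuallyEq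
      (Filter.Eventually.of_forall fun x => ?_)
    simp only [Function.comp_apply, Pi.add_apply]
    ring
  have hsplit : D (ξ, η) = D (ξ, 0) + D (0, η) := by rw [← map_add]; simp
  rw [gradient, gradient, InnerProductSpace.toDual_symm_apply,
    InnerProductSpace.toDual_symm_apply, hq.fderiv, hv.fderiv, hsplit]
  simp only [sub_apply, add_apply,
    ContinuousLinearMap.comp_apply, ContinuousLinearMap.inl_apply, ContinuousLinearMap.inr_apply,
    smul_apply, innerSL_apply_apply, smul_eq_mul, nsmul_eq_mul, Nat.cast_ofNat]
  rw [mul_inv]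
  ring

namespace W12Loop

variable {γ g : ℝ → E n}

lemma continuous (hγ : W12Loop n γ g) : Continuous γ := by
  rw [show γ = fun t => γ 0 + ∫ u in (0 : ℝ)..t, g u from funext hγ.repr]
  exact continuous_const.add (intervalIntegral.continuous_primitive hγ.locint 0)

lemma intervalIntegrable_inner (hγ : W12Loop n γ g) (e : E n) (a b : ℝ) :
    IntervalIntegrable (fun t => ⟪g t, e⟫) volume a b := by
  simp_rw [real_inner_comm e]
  exact ⟨(innerSL ℝ e).integrable_comp (hγ.locint a b).1,
    (innerSL ℝ e).integrable_comp (hγ.locint a b).2⟩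

lemma inner_repr (hγ : W12Loop n γ g) (e : E n) (t : ℝ) :
    ⟪γ t, e⟫ = ⟪γ 0, e⟫ + ∫ u in (0 : ℝ)..t, ⟪g u, e⟫ := by
  have := (innerSL ℝ e).intervalIntegral_comp_comm (hγ.locint 0 t)
  simp only [innerSL_apply_apply] at this
  rw [hγ.repr t, inner_add_left, real_inner_comm e (∫ u in (0 : ℝ)..t, g u), ← this]
  simp_rw [real_inner_comm e]

end W12Loop

/-- The action differential along `z • e` of a Lagrangian which is `C¹`-close to
`|v|²/(4a) - a|q|²` differs from that of the quadratic Lagrangian by a bounded term. -/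
lemma abs_integral_quadratic_le_abs_dSL_add {L : ℝ → E n → E n → ℝ}
    (hL : ContDiff ℝ (⊤ : ℕ∞) (fun z : ℝ × E n × E n => L z.1 z.2.1 z.2.2)) {a C : ℝ}
    (hC : ∀ (t : ℝ) (z : E n × E n), ‖fderiv ℝ
      (fun w : E n × E n => L t w.1 w.2 - (‖w.2‖ ^ 2 / (4 * a) - a * ‖w.1‖ ^ 2)) z‖ ≤ C)
    {γ g : ℝ → E n} (hγ : W12Loop n γ g) {e : E n} (he : ‖e‖ ≤ 1) {x y : ℝ → ℝ}
    (hxy : ∀ t, HasDerivAt x (y t) t) (hy : Continuous y)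
    (hx1 : ∀ t, |x t| ≤ 1) (hy1 : ∀ t, |y t| ≤ 1) :
    |∫ t in (0 : ℝ)..1, (⟪g t, e⟫ * y t / (2 * a) - 2 * a * (⟪γ t, e⟫ * x t))|
      ≤ |dSL L γ g (fun t => x t • e)| + C := by
  have hx : Continuous x := continuous_iff_continuousAt.2 fun t => (hxy t).continuousAt
  have hγc := hγ.continuous
  set G : ℝ × E n × E n → ℝ :=
    fun z => L z.1 z.2.1 z.2.2 - (‖z.2.2‖ ^ 2 / (4 * a) - a * ‖z.2.1‖ ^ 2) with hG
  have hGs : ContDiff ℝ (⊤ : ℕ∞) G :=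
    hL.sub (((contDiff_snd.snd.norm_sq ℝ).div_const _).sub
      (contDiff_const.mul (contDiff_snd.fst.norm_sq ℝ)))
  have hslice : ∀ t (w : E n × E n), HasFDerivAt
      (fun w : E n × E n => L t w.1 w.2 - (‖w.2‖ ^ 2 / (4 * a) - a * ‖w.1‖ ^ 2))
      ((fderiv ℝ G (t, w)).comp (ContinuousLinearMap.inr ℝ ℝ (E n × E n))) w := fun t w =>
    ((hGs.differentiable (by simp)) (t, w)).hasFDerivAt.comp w (hasFDerivAt_prodMk_right t w)
  set r : ℝ → ℝ := fun t => fderiv ℝ G (t, γ t, g t) (0, x t • e, y t • e) with hr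
  have hrbound : ∀ t, ‖r t‖ ≤ C := by
    intro t
    have h1 := hC t (γ t, g t)
    rw [(hslice t (γ t, g t)).fderiv] at h1
    have h2 : ‖(x t • e, y t • e)‖ ≤ 1 := by
      rw [Prod.norm_def, norm_smul, norm_smul]
      exact max_le (mul_le_one₀ (hx1 t) (norm_nonneg _) he)
        (mul_le_one₀ (hy1 t) (norm_nonneg _) he)
    simpa using ContinuousLinearMap.le_of_opNorm_le_of_le _ h1 h2
  have hrmeas : Measurable r := by
    have hcont : Continuous fun z : (ℝ × E n × E n) × (ℝ × E n × E n) =>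
        fderiv ℝ G z.1 z.2 :=
      ((hGs.continuous_fderiv (by simp)).comp continuous_fst).clm_apply continuous_snd
    exact hcont.measurable.comp
      ((measurable_id.prodMk (hγc.measurable.prodMk hγ.meas)).prodMk
        (measurable_const.prodMk ((hx.smul continuous_const).measurable.prodMk
          (hy.smul continuous_const).measurable)))
  have hrint : IntervalIntegrable r volume 0 1 :=
    (intervalIntegrable_const (c := C)).mono_fun hrmeas.aestronglyMeasurable
      (Filter.Eventually.of_forall fun t => (hrbound t).trans (Real.le_norm_self C))
  have hqint : IntervalIntegrable
      (fun t => ⟪g t, e⟫ * y t / (2 * a) - 2 * a * (⟪γ t, e⟫ * x t)) volume 0 1 :=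
    (((hγ.intervalIntegrable_inner e 0 1).mul_continuousOn hy.continuousOn).div_const _).sub
      (Continuous.intervalIntegrable (by fun_prop) _ _)
  have hdS : dSL L γ g (fun t => x t • e)
      = (∫ t in (0 : ℝ)..1, (⟪g t, e⟫ * y t / (2 * a) - 2 * a * (⟪γ t, e⟫ * x t)))
        + ∫ t in (0 : ℝ)..1, r t := by
    rw [← intervalIntegral.integral_add hqint hrint, dSL]
    congr 1; funext t
    rw [((hxy t).smul_const e).deriv,
      inner_gradient_add_inner_gradient (hslice t (γ t, g t)), inner_smul_right, inner_smul_right]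
    simp only [hr, ContinuousLinearMap.comp_apply, ContinuousLinearMap.inr_apply]
    ring
  have hrest : |∫ t in (0 : ℝ)..1, r t| ≤ C := by
    simpa using intervalIntegral.norm_integral_le_of_norm_le_const (a := 0) (b := 1)
      (fun t _ => hrbound t)
  rw [hdS]
  set I := ∫ t in (0 : ℝ)..1, (⟪g t, e⟫ * y t / (2 * a) - 2 * a * (⟪γ t, e⟫ * x t))
  set J := ∫ t in (0 : ℝ)..1, r t
  calc |I| = |(I + J) - J| := by rw [add_sub_cancel_right]
    _ ≤ |I + J| + |J| := abs_sub _ _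
    _ ≤ |I + J| + C := by gcongr

/-- The differential of the quadratic action on solutions of the forced oscillator equation. -/
lemma W12Loop.integral_quadratic_eq {γ g : ℝ → E n} (hγ : W12Loop n γ g) {a c : ℝ} (ha : a ≠ 0)
    (e : E n) {x y h : ℝ → ℝ} (hx : Continuous x) (hy : ContDiff ℝ 1 y) (hh : Continuous h)
    (hy1 : y 1 = y 0) (hyd : ∀ t, HasDerivAt y (2 * a * c * h t - 4 * a ^ 2 * x t) t) :
    ∫ t in (0 : ℝ)..1, (⟪g t, e⟫ * y t / (2 * a) - 2 * a * (⟪γ t, e⟫ * x t))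
      = -(c * ∫ t in (0 : ℝ)..1, ⟪γ t, e⟫ * h t) := by
  have hγc := hγ.continuous
  have hγ1 : γ 1 = γ 0 := by simpa using hγ.periodic 0
  have hint := hγ.intervalIntegrable_inner e 0 1
  have hxint : IntervalIntegrable (fun t => 2 * a * (⟪γ t, e⟫ * x t)) volume 0 1 :=
    Continuous.intervalIntegrable (by fun_prop) _ _
  have hhint : IntervalIntegrable (fun t => c * (⟪γ t, e⟫ * h t)) volume 0 1 :=
    Continuous.intervalIntegrable (by fun_prop) _ _
  rw [intervalIntegral.integral_sub ((hint.mul_continuousOn hy.continuous.continuousOn).div_const _)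
    hxint, intervalIntegral.integral_div, integral_mul_periodic_by_parts (u := fun t => ⟪γ t, e⟫)
    hint (hγ.inner_repr e) (by simp only [hγ1]) hy hy1, ← intervalIntegral.integral_const_mul]
  have : ∀ t, ⟪γ t, e⟫ * deriv y t
      = 2 * a * (c * (⟪γ t, e⟫ * h t) - 2 * a * (⟪γ t, e⟫ * x t)) := fun t => by
    rw [(hyd t).deriv]; ring
  simp_rw [this]
  rw [intervalIntegral.integral_const_mul, intervalIntegral.integral_sub hhint hxint]
  field_simp
  ring

end Lagrangian

/-- Lemma 3.3: if `L` satisfies (L1), then any sequence of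
`W^{1,2}`-loops with bounded action `𝒮_L` and bounded dual norm of `d𝒮_L`
is `C⁰`-bounded. -/
theorem stmt2 (n : ℕ) (L : ℝ → E n → E n → ℝ)
    (hLsmooth : ContDiff ℝ (⊤ : ℕ∞) (fun z : ℝ × E n × E n => L z.1 z.2.1 z.2.2))
    (hLper : ∀ t q v, L (t + 1) q v = L t q v)
    (hL1 : CondL1 L)
    (γ g : ℕ → ℝ → E n) (hloop : ∀ k, W12Loop n (γ k) (g k))
    (hS : ∃ A : ℝ, ∀ k, |SL L (γ k) (g k)| ≤ A)
    (hdS : ∃ B : ℝ, ∀ k, ∀ ξ : ℝ → E n, ContDiff ℝ (⊤ : ℕ∞) ξ →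
      (∀ t, ξ (t + 1) = ξ t) →
      (∫ t in (0 : ℝ)..1, ‖ξ t‖ ^ 2 + ‖deriv ξ t‖ ^ 2) ≤ 1 →
      |dSL L (γ k) (g k) ξ| ≤ B) :
    ∃ R : ℝ, ∀ k t, ‖γ k t‖ ≤ R := by
  obtain ⟨a, ha, hak, C, hC⟩ := hL1
  obtain ⟨B, hB⟩ := hdS
  have hsin : Real.sin a ≠ 0 := fun h0 => by
    obtain ⟨k, hk⟩ := Real.sin_eq_zero_iff.1 h0
    exact hak k hk.symm
  have hfd : ∀ (t : ℝ) (z : E n × E n), ‖fderiv ℝ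
      (fun w : E n × E n => L t w.1 w.2 - (‖w.2‖ ^ 2 / (4 * a) - a * ‖w.1‖ ^ 2)) z‖ ≤ C :=
    fun t z => by rw [← norm_iteratedFDeriv_one]; exact hC t z 1 one_le_two
  set M : ℝ := 1 + 2 * a with hM
  have hMpos : 0 < M := by positivity
  set c : ℝ := 2 * Real.sin a / M with hc
  have hc0 : c ≠ 0 := by positivity
  refine ⟨(B + C) / |c|, fun k s => ?_⟩
  have hγ := hloop k
  have hγc := hγ.continuous
  set e : E n := ‖γ k s‖⁻¹ • γ k s with he
  have he1 : ‖e‖ ≤ 1 := by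
    rw [he, norm_smul, norm_inv, norm_norm]
    exact inv_mul_le_one
  have hinner : ‖γ k s‖ = ⟪γ k s, e⟫ := by
    rw [he, inner_smul_right, real_inner_self_eq_norm_sq]
    rcases eq_or_ne ‖γ k s‖ 0 with h0 | h0
    · simp [h0]
    · field_simp
  rw [hinner]
  refine (le_abs_self _).trans (abs_le_of_abs_integral_density_le
    (u := fun t => ⟪γ k t, e⟫) (by fun_prop) (fun t => by simp only [hγ.periodic])
    (fun h hh hper hpos hmass => ?_) s)
  obtain ⟨x, y, hx, hy, hxper, hyper, hxd, hyd, hxb, hyb⟩ :=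
    exists_periodic_oscillator_solution ha hh hper hpos hmass
  have hscale : ∀ f : ℝ, |f| ≤ M → |M⁻¹ * f| ≤ 1 := fun f hf => by
    rw [abs_mul, abs_of_pos (inv_pos.2 hMpos)]
    exact inv_mul_le_one_of_le₀ hf hMpos.le
  have hxd' : ∀ t, HasDerivAt (fun t => M⁻¹ * x t) (M⁻¹ * y t) t := fun t => (hxd t).const_mul _
  have hnorm : (∫ t in (0 : ℝ)..1, ‖(M⁻¹ * x t) • e‖ ^ 2
      + ‖deriv (fun t => (M⁻¹ * x t) • e) t‖ ^ 2) ≤ 1 := by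
    have hpt : ∀ t, ‖‖(M⁻¹ * x t) • e‖ ^ 2 + ‖deriv (fun t => (M⁻¹ * x t) • e) t‖ ^ 2‖ ≤ 1 := by
      intro t
      have hsq : ∀ f b : ℝ, |f| ≤ b → ‖(M⁻¹ * f) • e‖ ^ 2 ≤ M⁻¹ ^ 2 * b ^ 2 := by
        intro f b hf
        rw [← mul_pow, norm_smul, norm_mul, Real.norm_eq_abs f,
          Real.norm_of_nonneg (inv_pos.2 hMpos).le]
        have : M⁻¹ * |f| * ‖e‖ ≤ M⁻¹ * |f| :=
          mul_le_of_le_one_right (by positivity) he1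
        exact pow_le_pow_left₀ (by positivity) (this.trans (by gcongr)) 2
      rw [((hxd' t).smul_const e).deriv, Real.norm_of_nonneg (by positivity)]
      calc _ ≤ M⁻¹ ^ 2 * 1 ^ 2 + M⁻¹ ^ 2 * (2 * a) ^ 2 :=
            add_le_add (hsq _ _ (hxb t)) (hsq _ _ (hyb t))
        _ ≤ M⁻¹ ^ 2 * M ^ 2 := by
            rw [← mul_add, hM]
            gcongr
            nlinarith
        _ = 1 := by rw [← mul_pow, inv_mul_cancel₀ hMpos.ne', one_pow]
    have := intervalIntegral.norm_integral_le_of_norm_le_const (a := 0) (b := 1)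
      (fun t _ => hpt t)
    simpa using (Real.le_norm_self _).trans this
  have hdS := hB k (fun t => (M⁻¹ * x t) • e) (by fun_prop)
    (fun t => by simp only [hxper]) hnorm
  have hquad := abs_integral_quadratic_le_abs_dSL_add hLsmooth hfd hγ he1 hxd'
    (hy.continuous.const_mul _) (fun t => hscale _ ((hxb t).trans (by linarith)))
    (fun t => hscale _ ((hyb t).trans (by linarith)))
  rw [hγ.integral_quadratic_eq (c := c) (h := h) ha.ne' e (hx.continuous.const_mul _)
    ((contDiff_const.mul hy).of_le (by simp)) hh.continuous
    (by have := hyper 0; rw [zero_add] at this; rw [this])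
    (fun t => ((hyd t).const_mul M⁻¹).congr_deriv (by rw [hc]; ring)), abs_neg, abs_mul] at hquad
  rw [le_div_iff₀' (abs_pos.2 hc0)]
  linarith

end
end
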